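/- arXiv:0801.3567 — 2 statements merged into one kernel-verified Lean document; each statement's English description precedes it below -/
import Mathlib

section
/- Suppose α ∈ (0, 4−√15). Then there exists a constant H > 0 such that for every integer n ≥ 1 and every componentwise Lipschitz K : [0,1]^n → ℝ with inf_j Lip_j(K) > 0, Σ_{k=1}^n Q_k ≤ H · Σ_{j=1}^n Lip_j(K)², where Q_k = Σ_{ℓ=1}^∞ |I_ℓ| · sup { Γ_k(x,x')² : x ∈ I_ℓ, x' ∈ I_0, T(x) = T(x') }. -/
open MeasureTheory Set

/-- `Ψ_k(x) = ∑_{y : T^k y = x} [h(y)/(h(x)|(T^k)'(y)|)]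
      K(y, Ty, …, T^{k-1}y, 0, Tx, …, T^{n-k-1}x)`, where
`|(T^k)'(y)| = |∏_{j<k} T'(T^j y)|` and the preimages `y` range over `(0,1]`. -/
noncomputable def PsiFun (T T' h : ℝ → ℝ) (n k : ℕ) (K : (Fin n → ℝ) → ℝ) (x : ℝ) : ℝ :=
  ∑' y : {y : ℝ // y ∈ Set.Ioc (0:ℝ) 1 ∧ T^[k] y = x},
    h y / (h x * |∏ j ∈ Finset.range k, T' (T^[j] (y:ℝ))|) *
      K (fun i => if (i:ℕ) < k then T^[(i:ℕ)] (y:ℝ)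
                  else if (i:ℕ) = k then 0 else T^[(i:ℕ) - k] x)

/-- `Γ_k(x,x') = Ψ_k(x) - Ψ_k(x')`. -/
noncomputable def GammaFun (T T' h : ℝ → ℝ) (n k : ℕ) (K : (Fin n → ℝ) → ℝ)
    (x x' : ℝ) : ℝ :=
  PsiFun T T' h n k K x - PsiFun T T' h n k K x'


def QQ (a b p : ℝ → ℝ) (V : ℝ → ℝ → ℝ) (z z' : ℝ) : ℝ :=
  min (p z) (p z') * V (a z) (a z') + min (1 - p z) (1 - p z') * V (b z) (b z')
    + max (p z - p z') 0 * V (a z) (b z') + max (p z' - p z) 0 * V (b z) (a z')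

def UU (a b p : ℝ → ℝ) : ℕ → ℝ → ℝ → ℝ
  | 0 => fun z z' => |z - z'|
  | (j+1) => QQ a b p (UU a b p j)

structure CplSys (α p0 c1 C2 c3 : ℝ) (a b p : ℝ → ℝ) (SA : ℝ → ℝ → Prop)
    (ρ : ℝ → ℝ → ℝ) : Prop where
  hα : 0 < α
  hp0 : 0 < p0
  hc1 : 0 < c1
  hC2 : 0 < C2
  hc3 : 0 < c3
  a_mem : ∀ z ∈ Ioo (0:ℝ) 1, a z ∈ Ioo (0:ℝ) 1
  b_mem : ∀ z ∈ Ioo (0:ℝ) 1, b z ∈ Ioo (0:ℝ) 1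
  p_ge : ∀ z ∈ Ioo (0:ℝ) 1, p0 ≤ p z
  q_ge : ∀ z ∈ Ioo (0:ℝ) 1, c3 * z ^ α ≤ 1 - p z
  p_diff : ∀ z ∈ Ioo (0:ℝ) 1, ∀ z' ∈ Ioo (0:ℝ) 1, SA z z' →
    |p z - p z'| ≤ C2 * (min z z') ^ α * ρ z z'
  SA_a : ∀ z ∈ Ioo (0:ℝ) 1, ∀ z' ∈ Ioo (0:ℝ) 1, SA z z' → SA (a z) (a z')
  SA_b : ∀ z ∈ Ioo (0:ℝ) 1, ∀ z' ∈ Ioo (0:ℝ) 1, SA (b z) (b z')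
  ρ_le : ∀ z ∈ Ioo (0:ℝ) 1, ∀ z' ∈ Ioo (0:ℝ) 1, SA z z' → ρ z z' ≤ 1
  ρ_ge : ∀ z ∈ Ioo (0:ℝ) 1, ∀ z' ∈ Ioo (0:ℝ) 1, SA z z' → |z - z'| ≤ ρ z z'
  ρ_a : ∀ z ∈ Ioo (0:ℝ) 1, ∀ z' ∈ Ioo (0:ℝ) 1, SA z z' →
    ρ (a z) (a z') ≤ (1 - c1 * (min z z') ^ α) * ρ z z'
  ρ_b : ∀ z ∈ Ioo (0:ℝ) 1, ∀ z' ∈ Ioo (0:ℝ) 1, SA z z' → ρ (b z) (b z') ≤ ρ z z'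

lemma QQ_w_sum (p p' : ℝ) :
    min p p' + min (1 - p) (1 - p') + max (p - p') 0 + max (p' - p) 0 = 1 := by
  rcases le_total p p' with h | h
  · rw [min_eq_left h, min_eq_right (by linarith), max_eq_right (by linarith),
      max_eq_left (by linarith)]; ring
  · rw [min_eq_right h, min_eq_left (by linarith), max_eq_left (by linarith),
      max_eq_right (by linarith)]; ring

lemma max_add_abs (p p' : ℝ) : max (p - p') 0 + max (p' - p) 0 = |p - p'| := by
  rcases le_total p p' with h | h
  · rw [max_eq_right (by linarith), max_eq_left (by linarith), abs_of_nonpos (by linarith)]; ring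
  · rw [max_eq_left (by linarith), max_eq_right (by linarith), abs_of_nonneg (by linarith)]; ring

lemma QQ_mono {α p0 c1 C2 c3 : ℝ} {a b p : ℝ → ℝ} {SA : ℝ → ℝ → Prop} {ρ : ℝ → ℝ → ℝ}
    (S : CplSys α p0 c1 C2 c3 a b p SA ρ) {V W : ℝ → ℝ → ℝ}
    (hVW : ∀ z ∈ Ioo (0:ℝ) 1, ∀ z' ∈ Ioo (0:ℝ) 1, V z z' ≤ W z z')
    {z z' : ℝ} (hz : z ∈ Ioo (0:ℝ) 1) (hz' : z' ∈ Ioo (0:ℝ) 1) :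
    QQ a b p V z z' ≤ QQ a b p W z z' := by
  have hq : ∀ z ∈ Ioo (0:ℝ) 1, 0 ≤ 1 - p z := fun z hz =>
    le_trans (mul_nonneg S.hc3.le (Real.rpow_nonneg hz.1.le _)) (S.q_ge z hz)
  have hp : ∀ z ∈ Ioo (0:ℝ) 1, 0 ≤ p z := fun z hz => S.hp0.le.trans (S.p_ge z hz)
  have A := S.a_mem z hz
  have A' := S.a_mem z' hz'
  have B := S.b_mem z hz
  have B' := S.b_mem z' hz'
  unfold QQ
  have h1 : 0 ≤ min (p z) (p z') := le_min (hp z hz) (hp z' hz')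
  have h2 : 0 ≤ min (1 - p z) (1 - p z') := le_min (hq z hz) (hq z' hz')
  have := hVW _ A _ A'
  have := hVW _ B _ B'
  have := hVW _ A _ B'
  have := hVW _ B _ A'
  gcongr

set_option maxHeartbeats 800000 in
lemma theta_exists {α p0 c1 C2 c3 : ℝ} {a b p : ℝ → ℝ} {SA : ℝ → ℝ → Prop} {ρ : ℝ → ℝ → ℝ}
    (S : CplSys α p0 c1 C2 c3 a b p SA ρ) :
    ∃ (θ : ℝ → ℝ → ℝ) (ε c : ℝ), 0 < ε ∧ 0 < c ∧ ∀ z ∈ Ioo (0:ℝ) 1, ∀ z' ∈ Ioo (0:ℝ) 1,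
      0 ≤ θ z z' ∧ θ z z' ≤ 1 ∧ c * |z - z'| ≤ θ z z' ∧
      QQ a b p θ z z' ≤ (1 - ε * (min z z') ^ α) * θ z z' := by
  classical
  obtain ⟨M, hM⟩ : ∃ M, M = (C2 + 1) / (p0 * c1) := ⟨_, rfl⟩
  have hp0 := S.hp0
  have hc1 := S.hc1
  have hC2 := S.hC2
  have hc3 := S.hc3
  have hMpos : 0 < M := by rw [hM]; positivity
  have hMe : p0 * c1 * M = C2 + 1 := by rw [hM]; field_simp
  have hE : 0 < Real.exp (-M) := Real.exp_pos _
  let θ : ℝ → ℝ → ℝ := fun z z' => if SA z z' then 1 - Real.exp (-(M * ρ z z')) else 1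
  have hθ1 : ∀ z z', θ z z' ≤ 1 := by
    intro z z'
    simp only [θ]
    split_ifs
    · linarith [Real.exp_pos (-(M * ρ z z'))]
    · exact le_rfl
  have hθSA : ∀ z z', SA z z' → θ z z' = 1 - Real.exp (-(M * ρ z z')) := by
    intro z z' h
    simp only [θ, if_pos h]
  have hρ0 : ∀ z ∈ Ioo (0:ℝ) 1, ∀ z' ∈ Ioo (0:ℝ) 1, SA z z' → 0 ≤ ρ z z' := fun z hz z' hz' h =>
    (abs_nonneg _).trans (S.ρ_ge z hz z' hz' h)
  refine ⟨θ, min (Real.exp (-M) / M) (c3 * Real.exp (-M)), min 1 (M * Real.exp (-M)), by positivity,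
    by positivity, ?_⟩
  intro z hz z' hz'
  have hm : z ⊓ z' ∈ Ioo (0:ℝ) 1 := ⟨lt_min hz.1 hz'.1, min_lt_of_left_lt hz.2⟩
  have hv : 0 < (min z z') ^ α := Real.rpow_pos_of_pos hm.1 _
  have hq : ∀ z ∈ Ioo (0:ℝ) 1, 0 ≤ 1 - p z := fun z hz =>
    le_trans (mul_nonneg S.hc3.le (Real.rpow_nonneg hz.1.le _)) (S.q_ge z hz)
  have hP : p0 ≤ min (p z) (p z') := le_min (S.p_ge z hz) (S.p_ge z' hz')
  have hQ : 0 ≤ min (1 - p z) (1 - p z') := le_min (hq z hz) (hq z' hz')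
  have hsum := QQ_w_sum (p z) (p z')
  have hA := S.a_mem z hz
  have hA' := S.a_mem z' hz'
  have hB := S.b_mem z hz
  have hB' := S.b_mem z' hz'
  have hbb : θ (b z) (b z') = 1 - Real.exp (-(M * ρ (b z) (b z'))) := hθSA _ _ (S.SA_b z hz z' hz')
  have hX1 : max (p z - p z') 0 * θ (a z) (b z') ≤ max (p z - p z') 0 :=
    mul_le_of_le_one_right (le_max_right _ _) (hθ1 _ _)
  have hX2 : max (p z' - p z) 0 * θ (b z) (a z') ≤ max (p z' - p z) 0 :=
    mul_le_of_le_one_right (le_max_right _ _) (hθ1 _ _)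
  by_cases hSA : SA z z'
  · have hr0 := hρ0 z hz z' hz' hSA
    have hr1 := S.ρ_le z hz z' hz' hSA
    have hrg := S.ρ_ge z hz z' hz' hSA
    have hra := S.ρ_a z hz z' hz' hSA
    have hrb := S.ρ_b z hz z' hz' hSA
    have hpd := S.p_diff z hz z' hz' hSA
    have hab := max_add_abs (p z) (p z')
    have haa : θ (a z) (a z') = 1 - Real.exp (-(M * ρ (a z) (a z'))) :=
      hθSA _ _ (S.SA_a z hz z' hz' hSA)
    have hth := hθSA z z' hSA
    set r := ρ z z' with hr
    set v := (min z z') ^ α with hvd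
    have he : Real.exp (-(M * r)) ≤ 1 := Real.exp_le_one_iff.2 (by have : 0 ≤ M * r := by positivity
                                                                   linarith)
    have heM : Real.exp (-M) ≤ Real.exp (-(M * r)) := Real.exp_le_exp.2 (by nlinarith)
    have hlow : M * Real.exp (-M) * r ≤ θ z z' := by
      rw [hth]
      have h1 : M * r + 1 ≤ Real.exp (M * r) := Real.add_one_le_exp _
      have h2 : Real.exp (M * r) * Real.exp (-(M * r)) = 1 := by rw [← Real.exp_add]; simp
      have h3 : (M * r + 1) * Real.exp (-(M * r)) ≤ 1 := by
        calc _ ≤ Real.exp (M * r) * Real.exp (-(M * r)) := by gcongr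
          _ = 1 := h2
      have : M * r * Real.exp (-M) ≤ M * r * Real.exp (-(M * r)) := by gcongr
      nlinarith
    have hup : θ z z' ≤ M * r := by
      rw [hth]
      have := Real.add_one_le_exp (-(M * r))
      linarith
    refine ⟨by rw [hth]; linarith, hθ1 _ _, ?_, ?_⟩
    · calc min 1 (M * Real.exp (-M)) * |z - z'| ≤ (M * Real.exp (-M)) * r := by
            gcongr
            exact min_le_right _ _
        _ ≤ _ := hlow
    · have hea : Real.exp (-(M * r)) * (1 + M * (c1 * v * r)) ≤ Real.exp (-(M * ρ (a z) (a z'))) := by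
        have h1 : M * (c1 * v * r) + 1 ≤ Real.exp (M * (c1 * v * r)) := Real.add_one_le_exp _
        calc Real.exp (-(M * r)) * (1 + M * (c1 * v * r))
            ≤ Real.exp (-(M * r)) * Real.exp (M * (c1 * v * r)) := by
              gcongr; linarith
          _ = Real.exp (-(M * r) + M * (c1 * v * r)) := by rw [Real.exp_add]
          _ ≤ _ := by
              apply Real.exp_le_exp.2
              nlinarith
      have heb : Real.exp (-(M * r)) ≤ Real.exp (-(M * ρ (b z) (b z'))) := by
        apply Real.exp_le_exp.2
        nlinarith
      have hkey : QQ a b p θ z z' ≤ 1 - Real.exp (-(M * r)) * (1 + v * r) := by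
        unfold QQ
        rw [haa, hbb]
        set P := min (p z) (p z')
        set Q := min (1 - p z) (1 - p z')
        have h1 : P * (Real.exp (-(M * r)) * (1 + M * (c1 * v * r)))
          ≤ P * Real.exp (-(M * ρ (a z) (a z'))) := by
          apply mul_le_mul_of_nonneg_left hea (by linarith)
        have h2 : Q * Real.exp (-(M * r)) ≤ Q * Real.exp (-(M * ρ (b z) (b z'))) :=
          mul_le_mul_of_nonneg_left heb hQ
        have h3 : 1 + v * r ≤ P * (1 + M * (c1 * v * r)) + Q := by
          have : (p0 * c1 * M) * (v * r) ≤ P * c1 * M * (v * r) := by gcongr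
          rw [hMe] at this
          have e1 : P * (1 + M * (c1 * v * r)) = P + P * c1 * M * (v * r) := by ring
          have e2 : (C2 + 1) * (v * r) = C2 * v * r + v * r := by ring
          linarith
        have h4 : Real.exp (-(M * r)) * (1 + v * r)
          ≤ Real.exp (-(M * r)) * (P * (1 + M * (c1 * v * r)) + Q) := by gcongr
        have h5 : Real.exp (-(M * r)) * (P * (1 + M * (c1 * v * r)) + Q)
          = P * (Real.exp (-(M * r)) * (1 + M * (c1 * v * r))) + Q * Real.exp (-(M * r)) := by ring
        rw [mul_one_sub, mul_one_sub]
        linarith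
      refine hkey.trans ?_
      have h5 : min (Real.exp (-M) / M) (c3 * Real.exp (-M)) * v * θ z z'
          ≤ (Real.exp (-M) / M) * v * (M * r) := by
        have : 0 ≤ θ z z' := by rw [hth]; linarith
        gcongr
        exact min_le_left _ _
      have h6 : (Real.exp (-M) / M) * v * (M * r) = Real.exp (-M) * (v * r) := by field_simp
      have h7 : Real.exp (-M) * (v * r) ≤ Real.exp (-(M * r)) * (v * r) := by gcongr
      rw [one_sub_mul, hth]
      rw [hth] at h5
      rw [mul_add, mul_one]
      linarith
  · have hth : θ z z' = 1 := by simp only [θ, if_neg hSA]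
    have habs : |z - z'| ≤ 1 := by
      rw [abs_le]; constructor <;> linarith [hz.1, hz.2, hz'.1, hz'.2]
    refine ⟨by rw [hth]; norm_num, hθ1 _ _, ?_, ?_⟩
    · rw [hth]
      calc min 1 (M * Real.exp (-M)) * |z - z'| ≤ 1 * 1 := by
            gcongr
            exact min_le_left _ _
        _ = 1 := by norm_num
    · rw [hth, mul_one]
      have hrb1 := S.ρ_le _ hB _ hB' (S.SA_b z hz z' hz')
      have heM : Real.exp (-M) ≤ Real.exp (-(M * ρ (b z) (b z'))) :=
        Real.exp_le_exp.2 (by nlinarith)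
      have hQ3 : c3 * (min z z') ^ α ≤ min (1 - p z) (1 - p z') := by
        apply le_min
        · refine le_trans ?_ (S.q_ge z hz)
          have := Real.rpow_le_rpow hm.1.le (min_le_left z z') S.hα.le
          gcongr
        · refine le_trans ?_ (S.q_ge z' hz')
          have := Real.rpow_le_rpow hm.1.le (min_le_right z z') S.hα.le
          gcongr
      have h1 : c3 * (min z z') ^ α * Real.exp (-M)
          ≤ min (1 - p z) (1 - p z') * Real.exp (-(M * ρ (b z) (b z'))) := by gcongr
      have h2 : min (p z) (p z') * θ (a z) (a z') ≤ min (p z) (p z') :=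
        mul_le_of_le_one_right (by linarith) (hθ1 _ _)
      have h3 : min (Real.exp (-M) / M) (c3 * Real.exp (-M)) * (min z z') ^ α
          ≤ (c3 * Real.exp (-M)) * (min z z') ^ α := by
        gcongr
        exact min_le_right _ _
      unfold QQ
      rw [hbb, mul_one_sub]
      have h4 : c3 * (min z z') ^ α * Real.exp (-M) = (c3 * Real.exp (-M)) * (min z z') ^ α := by ring
      linarith

lemma four_cs {w1 w2 w3 w4 x1 x2 x3 x4 y1 y2 y3 y4 : ℝ} (hw1 : 0 ≤ w1) (hw2 : 0 ≤ w2)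
    (hw3 : 0 ≤ w3) (hw4 : 0 ≤ w4) (hx1 : 0 ≤ x1) (hx2 : 0 ≤ x2) (hx3 : 0 ≤ x3) (hx4 : 0 ≤ x4)
    (hy1 : 0 ≤ y1) (hy2 : 0 ≤ y2) (hy3 : 0 ≤ y3) (hy4 : 0 ≤ y4) :
    w1 * (√x1 * √y1) + w2 * (√x2 * √y2) + w3 * (√x3 * √y3) + w4 * (√x4 * √y4)
      ≤ √(w1 * x1 + w2 * x2 + w3 * x3 + w4 * x4) * √(w1 * y1 + w2 * y2 + w3 * y3 + w4 * y4) := by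
  have h := Real.sum_sqrt_mul_sqrt_le (Finset.univ : Finset (Fin 4))
    (f := ![w1 * x1, w2 * x2, w3 * x3, w4 * x4]) (g := ![w1 * y1, w2 * y2, w3 * y3, w4 * y4])
    (by intro i; fin_cases i <;> simp <;> positivity)
    (by intro i; fin_cases i <;> simp <;> positivity)
  simp only [Fin.sum_univ_four] at h
  have e : ∀ w x y : ℝ, 0 ≤ w → w * (√x * √y) = √(w * x) * √(w * y) := by
    intro w x y hw
    rw [Real.sqrt_mul hw, Real.sqrt_mul hw]
    have := Real.mul_self_sqrt hw
    calc w * (√x * √y) = (√w * √w) * (√x * √y) := by rw [this]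
      _ = _ := by ring
  rw [e _ _ _ hw1, e _ _ _ hw2, e _ _ _ hw3, e _ _ _ hw4]
  simpa using h

lemma QQ_marg (a b p f : ℝ → ℝ) (B z z' : ℝ) :
    QQ a b p (fun x y => f x + f y + B) z z' =
      (p z * f (a z) + (1 - p z) * f (b z)) + (p z' * f (a z') + (1 - p z') * f (b z')) + B := by
  unfold QQ
  rcases le_total (p z) (p z') with h | h
  · rw [min_eq_left h, min_eq_right (by linarith), max_eq_right (by linarith),
      max_eq_left (by linarith)]; ring
  · rw [min_eq_right h, min_eq_left (by linarith), max_eq_left (by linarith),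
      max_eq_right (by linarith)]; ring

lemma QQ_smul (a b p : ℝ → ℝ) (V : ℝ → ℝ → ℝ) (k z z' : ℝ) :
    QQ a b p (fun x y => k * V x y) z z' = k * QQ a b p V z z' := by
  unfold QQ; ring

set_option maxHeartbeats 800000 in
lemma W_exists {α p0 c1 C2 c3 : ℝ} {a b p : ℝ → ℝ} {SA : ℝ → ℝ → Prop} {ρ : ℝ → ℝ → ℝ}
    (S : CplSys α p0 c1 C2 c3 a b p SA ρ) (θ : ℝ → ℝ → ℝ) (ε : ℝ) (hε : 0 < ε) (hε1 : ε ≤ 1)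
    (hθ0 : ∀ z ∈ Ioo (0:ℝ) 1, ∀ z' ∈ Ioo (0:ℝ) 1, 0 ≤ θ z z')
    (hθQ : ∀ z ∈ Ioo (0:ℝ) 1, ∀ z' ∈ Ioo (0:ℝ) 1,
      QQ a b p θ z z' ≤ (1 - ε * (min z z') ^ α) * θ z z')
    (s : ℕ) (f : ℝ → ℝ) (cf Cf : ℝ) (hcf : 0 < cf) (hCf : 0 < Cf)
    (hf1 : ∀ z ∈ Ioo (0:ℝ) 1, cf / (z ^ α) ^ (2 * (s + 1)) ≤ f z)
    (hf2 : ∀ z ∈ Ioo (0:ℝ) 1, f z ≤ Cf / (z ^ α) ^ (2 * (s + 1)))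
    (hfd : ∀ z ∈ Ioo (0:ℝ) 1, p z * f (a z) + (1 - p z) * f (b z)
      ≤ f z - cf / (z ^ α) ^ (2 * s + 1) + Cf) :
    ∃ (W : ℝ → ℝ → ℝ) (C : ℝ), 0 < C ∧ ∀ z ∈ Ioo (0:ℝ) 1, ∀ z' ∈ Ioo (0:ℝ) 1,
      0 ≤ W z z' ∧ W z z' ≤ C * (√(θ z z') / ((min z z') ^ α) ^ (s + 1)) ∧
      √(θ z z') / ((min z z') ^ α) ^ s + QQ a b p W z z' ≤ W z z' := by
  obtain ⟨B, hB⟩ : ∃ B, B = 2 * Cf ^ 2 / (cf * ε) := ⟨_, rfl⟩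
  have hB0 : 0 < B := by rw [hB]; positivity
  have hfpos : ∀ z ∈ Ioo (0:ℝ) 1, 0 < f z := fun z hz =>
    lt_of_lt_of_le (by have := Real.rpow_pos_of_pos hz.1 α; positivity) (hf1 z hz)
  let F : ℝ → ℝ → ℝ := fun z z' => f z + f z' + B
  let k : ℝ := 4 / (ε * √cf)
  have hscf : 0 < √cf := Real.sqrt_pos.2 hcf
  have hk : 0 < k := by positivity
  have hF0 : ∀ z ∈ Ioo (0:ℝ) 1, ∀ z' ∈ Ioo (0:ℝ) 1, 0 ≤ F z z' := fun z hz z' hz' => by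
    have := hfpos z hz
    have := hfpos z' hz'
    simp only [F]; positivity
  refine ⟨fun z z' => k * (√(θ z z') * √(F z z')), k * √(2 * Cf + B), by positivity, ?_⟩
  intro z hz z' hz'
  have hm : min z z' ∈ Ioo (0:ℝ) 1 := ⟨lt_min hz.1 hz'.1, min_lt_of_left_lt hz.2⟩
  obtain ⟨v, hv⟩ : ∃ v, v = (min z z') ^ α := ⟨_, rfl⟩
  have hv0 : 0 < v := hv ▸ Real.rpow_pos_of_pos hm.1 _
  have hv1 : v ≤ 1 := hv ▸ Real.rpow_le_one hm.1.le hm.2.le S.hα.le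
  have hvz : v ≤ z ^ α := hv ▸ Real.rpow_le_rpow hm.1.le (min_le_left _ _) S.hα.le
  have hvz' : v ≤ z' ^ α := hv ▸ Real.rpow_le_rpow hm.1.le (min_le_right _ _) S.hα.le
  have hvor : v = z ^ α ∨ v = z' ^ α := by
    rcases min_choice z z' with h | h
    · left; rw [hv, h]
    · right; rw [hv, h]
  have hFlow : cf / v ^ (2 * (s + 1)) ≤ F z z' := by
    have h1 := hf1 z hz
    have h2 := hf1 z' hz'
    have h3 := hfpos z hz
    have h4 := hfpos z' hz'
    simp only [F]
    rcases hvor with h | h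
    · rw [h]; linarith
    · rw [h]; linarith
  have hFup : F z z' ≤ (2 * Cf + B) / v ^ (2 * (s + 1)) := by
    have h1 := hf2 z hz
    have h2 := hf2 z' hz'
    have h3 : Cf / (z ^ α) ^ (2 * (s + 1)) ≤ Cf / v ^ (2 * (s + 1)) := by gcongr
    have h4 : Cf / (z' ^ α) ^ (2 * (s + 1)) ≤ Cf / v ^ (2 * (s + 1)) := by gcongr
    have h5 : B ≤ B / v ^ (2 * (s + 1)) := by
      rw [le_div_iff₀ (by positivity)]
      exact mul_le_of_le_one_right hB0.le (pow_le_one₀ hv0.le hv1)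
    have : (2 * Cf + B) / v ^ (2 * (s + 1)) = Cf / v ^ (2 * (s + 1)) + Cf / v ^ (2 * (s + 1))
      + B / v ^ (2 * (s + 1)) := by ring
    rw [this]
    simp only [F]
    linarith
  have hsq : √(v ^ (2 * (s + 1))) = v ^ (s + 1) := by
    rw [mul_comm, pow_mul]
    exact Real.sqrt_sq (by positivity)
  have hQF : QQ a b p F z z' ≤ (1 + ε * v / 2) * F z z' := by
    have h0 : QQ a b p F z z' = _ := QQ_marg a b p f B z z'
    rw [h0]
    have h1 := hfd z hz
    have h2 := hfd z' hz'
    have hp1 : 0 < z ^ α := hv0.trans_le hvz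
    have hp2 : 0 < z' ^ α := hv0.trans_le hvz'
    have h3 : cf / v ^ (2 * s + 1) ≤ cf / (z ^ α) ^ (2 * s + 1) + cf / (z' ^ α) ^ (2 * s + 1) := by
      have : 0 < cf / (z ^ α) ^ (2 * s + 1) := by positivity
      have : 0 < cf / (z' ^ α) ^ (2 * s + 1) := by positivity
      rcases hvor with h | h
      · rw [h]; linarith
      · rw [h]; linarith
    have h4 : cf / v ≤ cf / v ^ (2 * s + 1) := by
      gcongr
      calc v ^ (2 * s + 1) ≤ v ^ 1 := pow_le_pow_of_le_one hv0.le hv1 (by omega)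
        _ = v := pow_one v
    have h5 : 2 * Cf ≤ cf / v + ε * v / 2 * B := by
      have : cf / v + ε * v / 2 * B - 2 * Cf = (cf - Cf * v) ^ 2 / (cf * v) := by
        rw [hB]; field_simp; ring
      have : 0 ≤ (cf - Cf * v) ^ 2 / (cf * v) := by positivity
      linarith
    have h6 : ε * v / 2 * B ≤ ε * v / 2 * F z z' := by
      have := hfpos z hz
      have := hfpos z' hz'
      simp only [F]
      gcongr
      linarith
    have h7 : F z z' = f z + f z' + B := rfl
    rw [one_add_mul]
    linarith
  have hpos : ∀ z ∈ Ioo (0:ℝ) 1, 0 ≤ 1 - p z := fun z hz =>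
    le_trans (mul_nonneg S.hc3.le (Real.rpow_nonneg hz.1.le _)) (S.q_ge z hz)
  have hP : 0 ≤ min (p z) (p z') := S.hp0.le.trans (le_min (S.p_ge z hz) (S.p_ge z' hz'))
  have hQ : 0 ≤ min (1 - p z) (1 - p z') := le_min (hpos z hz) (hpos z' hz')
  have hA := S.a_mem z hz
  have hA' := S.a_mem z' hz'
  have hBm := S.b_mem z hz
  have hB' := S.b_mem z' hz'
  have hQW : QQ a b p (fun z z' => √(θ z z') * √(F z z')) z z'
      ≤ √(QQ a b p θ z z') * √(QQ a b p F z z') := by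
    unfold QQ
    exact four_cs hP hQ (le_max_right _ _) (le_max_right _ _) (hθ0 _ hA _ hA') (hθ0 _ hBm _ hB')
      (hθ0 _ hA _ hB') (hθ0 _ hBm _ hA') (hF0 _ hA _ hA') (hF0 _ hBm _ hB')
      (hF0 _ hA _ hB') (hF0 _ hBm _ hA')
  have hθQ' := hθQ z hz z' hz'
  rw [← hv] at hθQ' ⊢
  have hεv : ε * v ≤ 1 := by nlinarith
  have hQW2 : QQ a b p (fun z z' => √(θ z z') * √(F z z')) z z'
      ≤ (1 - ε * v / 4) * (√(θ z z') * √(F z z')) := by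
    refine hQW.trans ?_
    have h0 : 0 ≤ 1 - ε * v := by linarith
    have h1 : √(QQ a b p θ z z') ≤ √(1 - ε * v) * √(θ z z') := by
      rw [← Real.sqrt_mul h0]; exact Real.sqrt_le_sqrt hθQ'
    have h2 : √(QQ a b p F z z') ≤ √(1 + ε * v / 2) * √(F z z') := by
      rw [← Real.sqrt_mul (by positivity)]; exact Real.sqrt_le_sqrt hQF
    have h3 : √(1 - ε * v) * √(1 + ε * v / 2) ≤ 1 - ε * v / 4 := by
      rw [← Real.sqrt_mul h0]
      apply Real.sqrt_le_iff.2
      constructor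
      · linarith
      · nlinarith [sq_nonneg (ε * v)]
    calc _ ≤ (√(1 - ε * v) * √(θ z z')) * (√(1 + ε * v / 2) * √(F z z')) := by gcongr
      _ = (√(1 - ε * v) * √(1 + ε * v / 2)) * (√(θ z z') * √(F z z')) := by ring
      _ ≤ _ := by gcongr
  refine ⟨by positivity, ?_, ?_⟩
  · have h1 : √(F z z') ≤ √(2 * Cf + B) / v ^ (s + 1) := by
      rw [← hsq, ← Real.sqrt_div (by positivity)]
      exact Real.sqrt_le_sqrt hFup
    calc k * (√(θ z z') * √(F z z')) ≤ k * (√(θ z z') * (√(2 * Cf + B) / v ^ (s + 1))) := by gcongr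
      _ = _ := by ring
  · rw [QQ_smul]
    have h1 : √cf / v ^ (s + 1) ≤ √(F z z') := by
      rw [← hsq, ← Real.sqrt_div (by positivity)]
      exact Real.sqrt_le_sqrt hFlow
    have h2 : √(θ z z') / v ^ s = k * (ε * v / 4) * (√(θ z z') * (√cf / v ^ (s + 1))) := by
      simp only [k]; field_simp; ring
    have h3 : k * (ε * v / 4) * (√(θ z z') * (√cf / v ^ (s + 1)))
        ≤ k * (ε * v / 4) * (√(θ z z') * √(F z z')) := by gcongr
    have h4 := mul_le_mul_of_nonneg_left hQW2 hk.le
    rw [h2]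
    refine (add_le_add h3 h4).trans (le_of_eq ?_)
    ring

lemma QQ_sum (a b p : ℝ → ℝ) (V : ℕ → ℝ → ℝ → ℝ) (w : ℕ → ℝ) (N : ℕ) (z z' : ℝ) :
    QQ a b p (fun x y => ∑ j ∈ Finset.range N, w j * V j x y) z z' =
      ∑ j ∈ Finset.range N, w j * QQ a b p (V j) z z' := by
  induction N with
  | zero => simp [QQ]
  | succ N ih =>
    rw [Finset.sum_range_succ, ← ih]
    simp only [Finset.sum_range_succ]
    unfold QQ; ring

lemma UU_mem {α p0 c1 C2 c3 : ℝ} {a b p : ℝ → ℝ} {SA : ℝ → ℝ → Prop} {ρ : ℝ → ℝ → ℝ}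
    (S : CplSys α p0 c1 C2 c3 a b p SA ρ) (j : ℕ) :
    ∀ z ∈ Ioo (0:ℝ) 1, ∀ z' ∈ Ioo (0:ℝ) 1, 0 ≤ UU a b p j z z' ∧ UU a b p j z z' ≤ 1 := by
  induction j with
  | zero =>
    intro z hz z' hz'
    refine ⟨abs_nonneg _, ?_⟩
    simp only [UU]
    rw [abs_le]; constructor <;> linarith [hz.1, hz.2, hz'.1, hz'.2]
  | succ j ih =>
    intro z hz z' hz'
    have h1 := QQ_mono S (V := fun _ _ => 0) (W := UU a b p j) (fun z hz z' hz' => (ih z hz z' hz').1) hz hz'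
    have h2 := QQ_mono S (W := fun _ _ => 1) (V := UU a b p j) (fun z hz z' hz' => (ih z hz z' hz').2) hz hz'
    have h3 : QQ a b p (fun _ _ => 0) z z' = 0 := by simp [QQ]
    have h4 : QQ a b p (fun _ _ => 1) z z' = 1 := by
      have := QQ_w_sum (p z) (p z')
      simpa [QQ] using this
    rw [h3] at h1; rw [h4] at h2
    exact ⟨h1, h2⟩

lemma green_step {α p0 c1 C2 c3 : ℝ} {a b p : ℝ → ℝ} {SA : ℝ → ℝ → Prop} {ρ : ℝ → ℝ → ℝ}
    (S : CplSys α p0 c1 C2 c3 a b p SA ρ) (w w' : ℕ → ℝ) (hw0 : w' 0 = w 0)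
    (hw : ∀ j, w' (j+1) = w (j+1) + w' j) (g W : ℝ → ℝ → ℝ) (C : ℝ) (hC : 0 ≤ C)
    (hg : ∀ N, ∀ z ∈ Ioo (0:ℝ) 1, ∀ z' ∈ Ioo (0:ℝ) 1,
      ∑ j ∈ Finset.range N, w j * UU a b p j z z' ≤ C * g z z')
    (hW : ∀ z ∈ Ioo (0:ℝ) 1, ∀ z' ∈ Ioo (0:ℝ) 1, 0 ≤ W z z' ∧ g z z' + QQ a b p W z z' ≤ W z z')
    (N : ℕ) : ∀ z ∈ Ioo (0:ℝ) 1, ∀ z' ∈ Ioo (0:ℝ) 1,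
      ∑ j ∈ Finset.range N, w' j * UU a b p j z z' ≤ C * W z z' := by
  induction N with
  | zero => intro z hz z' hz'; simpa using mul_nonneg hC (hW z hz z' hz').1
  | succ N ih =>
    intro z hz z' hz'
    have h1 := QQ_mono S ih hz hz'
    rw [QQ_sum, QQ_smul] at h1
    have h2 : ∑ j ∈ Finset.range (N+1), w' j * UU a b p j z z' =
      ∑ j ∈ Finset.range (N+1), w j * UU a b p j z z' +
        ∑ j ∈ Finset.range N, w' j * QQ a b p (UU a b p j) z z' := by
      rw [Finset.sum_range_succ', Finset.sum_range_succ' (fun j => w j * UU a b p j z z')]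
      have : ∀ j, w' (j+1) * UU a b p (j+1) z z' = w (j+1) * UU a b p (j+1) z z'
          + w' j * QQ a b p (UU a b p j) z z' := by
        intro j; rw [hw, add_mul]; rfl
      simp only [this, Finset.sum_add_distrib, hw0]
      ring
    rw [h2]
    have h3 := hg (N+1) z hz z' hz'
    have h4 := mul_le_mul_of_nonneg_left (hW z hz z' hz').2 hC
    linarith

lemma green_main {α p0 c1 C2 c3 : ℝ} {a b p : ℝ → ℝ} {SA : ℝ → ℝ → Prop} {ρ : ℝ → ℝ → ℝ}
    (S : CplSys α p0 c1 C2 c3 a b p SA ρ)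
    (hf : ∀ s : ℕ, s ≤ 2 → ∃ (f : ℝ → ℝ) (cf Cf : ℝ), 0 < cf ∧ 0 < Cf ∧
      (∀ z ∈ Ioo (0:ℝ) 1, cf / (z ^ α) ^ (2 * (s + 1)) ≤ f z) ∧
      (∀ z ∈ Ioo (0:ℝ) 1, f z ≤ Cf / (z ^ α) ^ (2 * (s + 1))) ∧
      (∀ z ∈ Ioo (0:ℝ) 1, p z * f (a z) + (1 - p z) * f (b z)
        ≤ f z - cf / (z ^ α) ^ (2 * s + 1) + Cf)) :
    ∃ C > (0:ℝ), ∀ N, ∀ z ∈ Ioo (0:ℝ) 1, ∀ z' ∈ Ioo (0:ℝ) 1,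
      ∑ j ∈ Finset.range N, (((j:ℝ) + 1) * (j + 2) / 2) * UU a b p j z z'
        ≤ C / ((min z z') ^ α) ^ 3 := by
  obtain ⟨θ, ε, c, hε, hc, hθ⟩ := theta_exists S
  have key : ∀ s : ℕ, s ≤ 2 → ∃ (W : ℝ → ℝ → ℝ) (C : ℝ), 0 < C ∧
      ∀ z ∈ Ioo (0:ℝ) 1, ∀ z' ∈ Ioo (0:ℝ) 1,
      0 ≤ W z z' ∧ W z z' ≤ C * (√(θ z z') / ((min z z') ^ α) ^ (s + 1)) ∧
      √(θ z z') / ((min z z') ^ α) ^ s + QQ a b p W z z' ≤ W z z' := by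
    intro s hs
    obtain ⟨f, cf, Cf, h1, h2, h3, h4, h5⟩ := hf s hs
    refine W_exists S θ (min ε 1) (by positivity) (min_le_right _ _)
      (fun z hz z' hz' => (hθ z hz z' hz').1) ?_ s f cf Cf h1 h2 h3 h4 h5
    intro z hz z' hz'
    refine (hθ z hz z' hz').2.2.2.trans ?_
    have : 0 ≤ (min z z') ^ α := Real.rpow_nonneg (le_min hz.1.le hz'.1.le) _
    have := (hθ z hz z' hz').1
    gcongr
    exact min_le_left _ _
  obtain ⟨W1, D1, hD1, hW1⟩ := key 0 (by norm_num)
  obtain ⟨W2, D2, hD2, hW2⟩ := key 1 (by norm_num)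
  obtain ⟨W3, D3, hD3, hW3⟩ := key 2 (by norm_num)
  have s1 := green_step S (fun j => if j = 0 then 1 else 0) (fun _ => 1) (by simp) (by simp)
    (fun z z' => √(θ z z') / ((min z z') ^ α) ^ 0) W1 c⁻¹ (by positivity) (by
      intro N z hz z' hz'
      obtain ⟨t0, t1, t2, -⟩ := hθ z hz z' hz'
      have h1 : θ z z' ≤ √(θ z z') := by
        apply Real.le_sqrt_of_sq_le
        nlinarith
      have h2 : ∑ j ∈ Finset.range N, (if j = 0 then (1:ℝ) else 0) * UU a b p j z z' ≤ |z - z'| := by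
        cases N with
        | zero => simp
        | succ N =>
          rw [Finset.sum_range_succ']
          simp [UU]
      rw [pow_zero, div_one]
      refine h2.trans ?_
      rw [inv_mul_eq_div, le_div_iff₀ hc]
      linarith) (fun z hz z' hz' => ⟨(hW1 z hz z' hz').1, (hW1 z hz z' hz').2.2⟩)
  have s2 := green_step S (fun _ => 1) (fun j => (j:ℝ) + 1) (by simp)
    (by intro j; push_cast; ring) (fun z z' => √(θ z z') / ((min z z') ^ α) ^ 1) W2 (c⁻¹ * D1)
    (by positivity) (by
      intro N z hz z' hz'
      refine (s1 N z hz z' hz').trans ?_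
      rw [mul_assoc]
      exact mul_le_mul_of_nonneg_left (hW1 z hz z' hz').2.1 (by positivity))
    (fun z hz z' hz' => ⟨(hW2 z hz z' hz').1, (hW2 z hz z' hz').2.2⟩)
  have s3 := green_step S (fun j => (j:ℝ) + 1) (fun j => ((j:ℝ) + 1) * (j + 2) / 2) (by simp)
    (by intro j; push_cast; ring) (fun z z' => √(θ z z') / ((min z z') ^ α) ^ 2) W3
    (c⁻¹ * D1 * D2)
    (by positivity) (by
      intro N z hz z' hz'
      refine (s2 N z hz z' hz').trans ?_
      rw [mul_assoc (c⁻¹ * D1)]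
      exact mul_le_mul_of_nonneg_left (hW2 z hz z' hz').2.1 (by positivity))
    (fun z hz z' hz' => ⟨(hW3 z hz z' hz').1, (hW3 z hz z' hz').2.2⟩)
  refine ⟨c⁻¹ * D1 * D2 * D3, by positivity, fun N z hz z' hz' => (s3 N z hz z' hz').trans ?_⟩
  have hm : 0 < min z z' := lt_min hz.1 hz'.1
  have hv := Real.rpow_pos_of_pos hm α
  have h1 : √(θ z z') ≤ 1 := Real.sqrt_le_one.2 (hθ z hz z' hz').2.1
  calc _ ≤ c⁻¹ * D1 * D2 * (D3 * (√(θ z z') / ((min z z') ^ α) ^ (2 + 1))) :=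
        mul_le_mul_of_nonneg_left (hW3 z hz z' hz').2.1 (by positivity)
    _ ≤ c⁻¹ * D1 * D2 * (D3 * (1 / ((min z z') ^ α) ^ (2 + 1))) := by gcongr
    _ = _ := by ring

lemma left_formula {α : ℝ} (hα0 : 0 < α) {T : ℝ → ℝ}
    (hT_formula : ∀ x ∈ Ico (0:ℝ) (1/2), T x = x + (2:ℝ) ^ α * x ^ (1 + α)) :
    ∀ x ∈ Ico (0:ℝ) (1/2), T x = x * (1 + (2 * x) ^ α) := by
  intro x hx
  rw [hT_formula x hx, Real.mul_rpow (by norm_num) hx.1]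
  rcases eq_or_lt_of_le hx.1 with h | h
  · rw [← h, Real.zero_rpow (by linarith)]; ring
  · rw [Real.rpow_add h, Real.rpow_one]; ring

lemma left_expand {α : ℝ} (hα0 : 0 < α) {T : ℝ → ℝ}
    (hT : ∀ x ∈ Ico (0:ℝ) (1/2), T x = x * (1 + (2 * x) ^ α)) :
    ∀ x ∈ Ico (0:ℝ) (1/2), ∀ y ∈ Ico (0:ℝ) (1/2), x ≤ y → y - x ≤ T y - T x := by
  intro x hx y hy hxy
  rw [hT x hx, hT y hy]
  have h1 : (2 * x) ^ α ≤ (2 * y) ^ α := Real.rpow_le_rpow (by linarith [hx.1]) (by linarith) hα0.le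
  have h2 : x * (2 * x) ^ α ≤ y * (2 * y) ^ α :=
    mul_le_mul hxy h1 (Real.rpow_nonneg (by linarith [hx.1]) _) hy.1
  nlinarith

lemma left_exists {α : ℝ} (hα0 : 0 < α) {T : ℝ → ℝ}
    (hT : ∀ x ∈ Ico (0:ℝ) (1/2), T x = x * (1 + (2 * x) ^ α)) :
    ∀ z ∈ Ioo (0:ℝ) 1, ∃ x ∈ Ioo (0:ℝ) (1/2), T x = z := by
  intro z hz
  have hc : ContinuousOn (fun x : ℝ => x * (1 + (2 * x) ^ α)) (Icc 0 (1/2)) := by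
    apply Continuous.continuousOn
    apply continuous_id.mul
    apply continuous_const.add
    exact Continuous.rpow_const (by fun_prop) (fun _ => Or.inr hα0.le)
  have := intermediate_value_Ioo (by norm_num : (0:ℝ) ≤ 1/2) hc
  have hz' : z ∈ Ioo ((0:ℝ) * (1 + (2 * 0) ^ α)) ((1/2) * (1 + (2 * (1/2)) ^ α)) := by
    norm_num
    exact hz
  obtain ⟨x, hx, hxz⟩ := this hz'
  exact ⟨x, hx, by rw [hT x ⟨hx.1.le, hx.2⟩]; exact hxz⟩

lemma left_deriv {α : ℝ} (hα0 : 0 < α) {T T' : ℝ → ℝ}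
    (hT_formula : ∀ x ∈ Ico (0:ℝ) (1/2), T x = x + (2:ℝ) ^ α * x ^ (1 + α))
    (hT_deriv : ∀ x ∈ Icc (0:ℝ) 1, x ≠ 1/2 → HasDerivAt T (T' x) x) :
    ∀ x ∈ Ioo (0:ℝ) (1/2), T' x = 1 + (1 + α) * (2 * x) ^ α := by
  intro x hx
  have h1 := hT_deriv x ⟨hx.1.le, by linarith [hx.2]⟩ hx.2.ne
  have h2 : HasDerivAt (fun x : ℝ => x + (2:ℝ) ^ α * x ^ (1 + α))
      (1 + (2:ℝ) ^ α * ((1 + α) * x ^ (1 + α - 1))) x :=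
    (hasDerivAt_id x).add ((Real.hasDerivAt_rpow_const (Or.inl hx.1.ne')).const_mul _)
  have h3 : HasDerivAt T (1 + (2:ℝ) ^ α * ((1 + α) * x ^ (1 + α - 1))) x := by
    apply h2.congr_of_eventuallyEq
    filter_upwards [Ioo_mem_nhds hx.1 hx.2] with y hy
    exact hT_formula y ⟨hy.1.le, hy.2⟩
  rw [h1.unique h3, Real.mul_rpow (by norm_num) hx.1.le]
  rw [show 1 + α - 1 = α by ring]; ring

lemma right_mono {T : ℝ → ℝ} (hT_C2 : ContDiffOn ℝ 2 T (Icc (1/2:ℝ) 1))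
    (hT_bij : BijOn T (Icc (1/2:ℝ) 1) (Icc (0:ℝ) 1)) :
    (StrictMonoOn T (Icc (1/2:ℝ) 1) ∧ T (1/2) = 0 ∧ T 1 = 1) ∨
    (StrictAntiOn T (Icc (1/2:ℝ) 1) ∧ T (1/2) = 1 ∧ T 1 = 0) := by
  have h12 : (1/2:ℝ) ∈ Icc (1/2:ℝ) 1 := ⟨le_rfl, by norm_num⟩
  have h11 : (1:ℝ) ∈ Icc (1/2:ℝ) 1 := ⟨by norm_num, le_rfl⟩
  obtain ⟨y0, hy0, hy0'⟩ := hT_bij.surjOn (show (0:ℝ) ∈ Icc (0:ℝ) 1 by simp)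
  obtain ⟨y1, hy1, hy1'⟩ := hT_bij.surjOn (show (1:ℝ) ∈ Icc (0:ℝ) 1 by simp)
  have m2 := hT_bij.mapsTo h12
  have m1 := hT_bij.mapsTo h11
  rcases ContinuousOn.strictMonoOn_of_injOn_Icc' (by norm_num : (1/2:ℝ) ≤ 1)
    hT_C2.continuousOn hT_bij.injOn with h | h
  · left
    refine ⟨h, ?_, ?_⟩
    · have := h.monotoneOn h12 hy0 hy0.1
      linarith [m2.1]
    · have := h.monotoneOn hy1 h11 hy1.2
      linarith [m1.2]
  · right
    refine ⟨h, ?_, ?_⟩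
    · have := h.antitoneOn h12 hy1 hy1.1
      linarith [m2.2]
    · have := h.antitoneOn hy0 h11 hy0.2
      linarith [m1.1]

lemma right_expand {T T' : ℝ → ℝ}
    (hT_deriv : ∀ x ∈ Icc (0:ℝ) 1, x ≠ 1/2 → HasDerivAt T (T' x) x)
    (hT_C2 : ContDiffOn ℝ 2 T (Icc (1/2:ℝ) 1))
    (hT_expanding : ∀ x ∈ Icc (1/2:ℝ) 1, 1 < |T' x|) :
    ∀ x ∈ Icc (1/2:ℝ) 1, ∀ y ∈ Icc (1/2:ℝ) 1, |x - y| ≤ |T x - T y| := by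
  have key : ∀ x ∈ Icc (1/2:ℝ) 1, ∀ y ∈ Icc (1/2:ℝ) 1, x < y → |x - y| ≤ |T x - T y| := by
    intro x hx y hy hxy
    obtain ⟨c, hc, hcs⟩ := exists_hasDerivAt_eq_slope T T' hxy
      (hT_C2.continuousOn.mono (Icc_subset_Icc hx.1 hy.2))
      (fun c hc => hT_deriv c ⟨by linarith [hx.1, hc.1], by linarith [hy.2, hc.2]⟩
        (by linarith [hx.1, hc.1] : (1/2:ℝ) < c).ne')
    have h1 := hT_expanding c ⟨by linarith [hx.1, hc.1], by linarith [hy.2, hc.2]⟩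
    rw [hcs, abs_div, lt_div_iff₀ (abs_pos.2 (by linarith))] at h1
    rw [abs_sub_comm, abs_sub_comm (T x)]
    linarith
  intro x hx y hy
  rcases lt_trichotomy x y with h | h | h
  · exact key x hx y hy h
  · simp [h]
  · rw [abs_sub_comm, abs_sub_comm (T x)]; exact key y hy x hx h

lemma right_bound {T T' : ℝ → ℝ}
    (hT_deriv : ∀ x ∈ Icc (0:ℝ) 1, x ≠ 1/2 → HasDerivAt T (T' x) x)
    (hT_C2 : ContDiffOn ℝ 2 T (Icc (1/2:ℝ) 1)) :
    ∃ Mx > 0, ∀ x ∈ Ioo (1/2:ℝ) 1, |T' x| ≤ Mx := by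
  have hU : UniqueDiffOn ℝ (Icc (1/2:ℝ) 1) := uniqueDiffOn_Icc (by norm_num)
  have hc := hT_C2.continuousOn_derivWithin hU (by norm_num)
  obtain ⟨M, hM⟩ := isCompact_Icc.exists_bound_of_continuousOn hc
  refine ⟨max M 1, by positivity, fun x hx => ?_⟩
  have h1 := hT_deriv x ⟨by linarith [hx.1], hx.2.le⟩ hx.1.ne'
  have h2 := (h1.hasDerivWithinAt (s := Icc (1/2:ℝ) 1)).derivWithin (hU x ⟨hx.1.le, hx.2.le⟩)
  have h3 := hM x ⟨hx.1.le, hx.2.le⟩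
  rw [h2, Real.norm_eq_abs] at h3
  exact h3.trans (le_max_left _ _)

/-- The basic facts on the two inverse branches. -/
structure Brn (α : ℝ) (T T' a b : ℝ → ℝ) (Mx : ℝ) : Prop where
  hMx : 0 < Mx
  a_mem : ∀ z ∈ Ioo (0:ℝ) 1, a z ∈ Ioo (0:ℝ) (1/2)
  b_mem : ∀ z ∈ Ioo (0:ℝ) 1, b z ∈ Ioo (1/2:ℝ) 1
  Ta : ∀ z ∈ Ioo (0:ℝ) 1, T (a z) = z
  Tb : ∀ z ∈ Ioo (0:ℝ) 1, T (b z) = z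
  pre : ∀ z ∈ Ioo (0:ℝ) 1, ∀ y ∈ Icc (0:ℝ) 1, T y = z → y = a z ∨ y = b z
  T0 : T 0 = 0
  za : ∀ z ∈ Ioo (0:ℝ) 1, z = a z * (1 + (2 * a z) ^ α)
  T'a : ∀ z ∈ Ioo (0:ℝ) 1, T' (a z) = 1 + (1 + α) * (2 * a z) ^ α
  T'b1 : ∀ z ∈ Ioo (0:ℝ) 1, 1 < |T' (b z)|
  T'b2 : ∀ z ∈ Ioo (0:ℝ) 1, |T' (b z)| ≤ Mx
  a_lip : ∀ z ∈ Ioo (0:ℝ) 1, ∀ z' ∈ Ioo (0:ℝ) 1, |a z - a z'| ≤ |z - z'|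
  b_lip : ∀ z ∈ Ioo (0:ℝ) 1, ∀ z' ∈ Ioo (0:ℝ) 1, |b z - b z'| ≤ |z - z'|
  a_mono : ∀ z ∈ Ioo (0:ℝ) 1, ∀ y ∈ Ico (0:ℝ) (1/2), y ≤ a z ↔ T y ≤ z

lemma Brn_exists {α : ℝ} (hα0 : 0 < α) {T T' : ℝ → ℝ}
    (hT_formula : ∀ x ∈ Ico (0:ℝ) (1/2), T x = x + (2:ℝ) ^ α * x ^ (1 + α))
    (hT_deriv : ∀ x ∈ Icc (0:ℝ) 1, x ≠ 1/2 → HasDerivAt T (T' x) x)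
    (hT_C2 : ContDiffOn ℝ 2 T (Icc (1/2:ℝ) 1))
    (hT_bij : BijOn T (Icc (1/2:ℝ) 1) (Icc (0:ℝ) 1))
    (hT_expanding : ∀ x ∈ Icc (1/2:ℝ) 1, 1 < |T' x|) :
    ∃ (a b : ℝ → ℝ) (Mx : ℝ), Brn α T T' a b Mx := by
  have hTL := left_formula hα0 hT_formula
  have hLE := left_expand hα0 hTL
  have hLX := left_exists hα0 hTL
  have hRX : ∀ z ∈ Ioo (0:ℝ) 1, ∃ x ∈ Ioo (1/2:ℝ) 1, T x = z := by
    intro z hz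
    obtain ⟨x, hx, hxz⟩ := hT_bij.surjOn ⟨hz.1.le, hz.2.le⟩
    have hne : x ≠ 1/2 ∧ x ≠ 1 := by
      rcases right_mono hT_C2 hT_bij with ⟨-, h1, h2⟩ | ⟨-, h1, h2⟩ <;>
      constructor <;> rintro rfl <;> first | linarith [hz.1] | linarith [hz.2]
    exact ⟨x, ⟨lt_of_le_of_ne hx.1 hne.1.symm, lt_of_le_of_ne hx.2 hne.2⟩, hxz⟩
  choose! a ha hTa using hLX
  choose! b hb hTb using hRX
  obtain ⟨Mx, hMx, hMb⟩ := right_bound hT_deriv hT_C2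
  have ico : ∀ z ∈ Ioo (0:ℝ) 1, a z ∈ Ico (0:ℝ) (1/2) := fun z hz => ⟨(ha z hz).1.le, (ha z hz).2⟩
  have icc : ∀ z ∈ Ioo (0:ℝ) 1, b z ∈ Icc (1/2:ℝ) 1 := fun z hz => ⟨(hb z hz).1.le, (hb z hz).2.le⟩
  have mono : ∀ z ∈ Ioo (0:ℝ) 1, ∀ y ∈ Ico (0:ℝ) (1/2), y ≤ a z ↔ T y ≤ z := by
    intro z hz y hy
    constructor
    · intro h
      have := hLE y hy _ (ico z hz) h
      rw [hTa z hz] at this; linarith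
    · intro h
      by_contra hc
      push Not at hc
      have := hLE _ (ico z hz) y hy hc.le
      rw [hTa z hz] at this; linarith
  refine ⟨a, b, Mx, hMx, ha, hb, hTa, hTb, ?_, ?_, ?_, ?_, ?_, ?_, ?_, ?_, mono⟩
  · intro z hz y hy hyz
    rcases lt_or_ge y (1/2) with h | h
    · left
      apply le_antisymm
      · exact (mono z hz y ⟨hy.1, h⟩).2 hyz.le
      · by_contra hc
        push Not at hc
        have := hLE y ⟨hy.1, h⟩ _ (ico z hz) hc.le
        rw [hTa z hz, hyz] at this; linarith
    · right
      exact hT_bij.injOn ⟨h, hy.2⟩ (icc z hz) (by rw [hyz, hTb z hz])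
  · rw [hTL 0 (by norm_num)]; ring
  · intro z hz
    rw [← hTL _ (ico z hz), hTa z hz]
  · intro z hz
    exact left_deriv hα0 hT_formula hT_deriv _ (ha z hz)
  · exact fun z hz => hT_expanding _ (icc z hz)
  · exact fun z hz => hMb _ (hb z hz)
  · intro z hz z' hz'
    have e := hTa z hz
    have e' := hTa z' hz'
    rcases le_total (a z) (a z') with h | h
    · have := hLE _ (ico z hz) _ (ico z' hz') h
      rw [e, e'] at this
      rw [abs_sub_comm, abs_of_nonneg (by linarith), abs_sub_comm, abs_of_nonneg (by linarith)]
      exact this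
    · have := hLE _ (ico z' hz') _ (ico z hz) h
      rw [e, e'] at this
      rw [abs_of_nonneg (by linarith), abs_of_nonneg (by linarith)]
      exact this
  · intro z hz z' hz'
    have := right_expand hT_deriv hT_C2 hT_expanding _ (icc z hz) _ (icc z' hz')
    rwa [hTb z hz, hTb z' hz'] at this

/-! atoms -/
lemma atom_exists {α : ℝ} (hα0 : 0 < α) {xpt : ℕ → ℝ} (hx0 : xpt 0 = 1)
    {cx Cx : ℝ}
    (hxasym : ∀ ℓ : ℕ, 1 ≤ ℓ →
      cx * (ℓ:ℝ) ^ (-(1/α)) ≤ xpt ℓ ∧ xpt ℓ ≤ Cx * (ℓ:ℝ) ^ (-(1/α))) :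
    ∀ z ∈ Ioc (0:ℝ) 1, ∃ ℓ, z ∈ Ioc (xpt (ℓ+1)) (xpt ℓ) := by
  intro z hz
  classical
  have hlim : Filter.Tendsto (fun ℓ : ℕ => Cx * (ℓ:ℝ) ^ (-(1/α))) Filter.atTop (nhds (Cx * 0)) := by
    apply Filter.Tendsto.const_mul
    exact (tendsto_rpow_neg_atTop (by positivity)).comp tendsto_natCast_atTop_atTop
  rw [mul_zero] at hlim
  have hex : ∃ ℓ, xpt ℓ < z := by
    obtain ⟨ℓ, h1, h2⟩ := ((hlim.eventually_lt_const hz.1).and (Filter.eventually_ge_atTop 1)).exists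
    exact ⟨ℓ, (hxasym ℓ h2).2.trans_lt h1⟩
  have hs := Nat.find_spec hex
  have hne : Nat.find hex ≠ 0 := by
    intro h
    rw [h, hx0] at hs
    linarith [hz.2]
  obtain ⟨m, hm⟩ := Nat.exists_eq_succ_of_ne_zero hne
  refine ⟨m, ?_, ?_⟩
  · rw [hm] at hs; exact hs
  · have := Nat.find_min hex (m := m) (by omega)
    exact not_lt.1 this

lemma a_atom {α : ℝ} {T T' a b : ℝ → ℝ} {Mx : ℝ} (B : Brn α T T' a b Mx)
    {xpt : ℕ → ℝ} (hx1 : xpt 1 = 1/2)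
    (hxpre : ∀ ℓ, 2 ≤ ℓ → xpt ℓ ∈ Ioo (0:ℝ) (1/2) ∧ T (xpt ℓ) = xpt (ℓ - 1)) :
    ∀ ℓ, ∀ z ∈ Ioo (0:ℝ) 1, z ∈ Ioc (xpt (ℓ+1)) (xpt ℓ) → a z ∈ Ioc (xpt (ℓ+2)) (xpt (ℓ+1)) := by
  intro ℓ z hz hzl
  obtain ⟨h1, h2⟩ := hxpre (ℓ+2) (by omega)
  have h2' : T (xpt (ℓ+2)) = xpt (ℓ+1) := by rw [h2]; congr 1
  constructor
  · have h3 := (B.a_mono z hz _ ⟨h1.1.le, h1.2⟩).2 (by rw [h2']; exact hzl.1.le)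
    refine lt_of_le_of_ne h3 fun h => ?_
    rw [h, B.Ta z hz] at h2'
    linarith [hzl.1]
  · rcases Nat.eq_zero_or_pos ℓ with h0 | h0
    · subst h0
      rw [hx1]; exact (B.a_mem z hz).2.le
    · obtain ⟨h3, h4⟩ := hxpre (ℓ+1) (by omega)
      have h4' : T (xpt (ℓ+1)) = xpt ℓ := by rw [h4]; congr 1
      by_contra hc
      push Not at hc
      have h5 := (B.a_mono z hz _ ⟨h3.1.le, h3.2⟩).1 hc.le
      rw [h4'] at h5
      have h6 : z = xpt ℓ := le_antisymm hzl.2 h5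
      rcases B.pre z hz _ ⟨h3.1.le, by linarith [h3.2]⟩ (h4'.trans h6.symm) with h7 | h7
      · linarith
      · linarith [(B.b_mem z hz).1, h3.2]

lemma h_cont {h : ℝ → ℝ} {l u C₁ : ℝ} (hl : 0 < l) (hC₁ : 0 < C₁)
    (hpos : ∀ y ∈ Ioc l u, 0 < h y)
    (hd : ∀ y ∈ Ioc l u, ∀ yt ∈ Ioc l u, h yt / h y ≤ 1 + C₁ * |y - yt| / y) :
    ∀ z ∈ Ioc l u, ContinuousWithinAt h (Ioc l u) z := by
  intro z hz
  have hz0 : 0 < z := hl.trans hz.1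
  have hhz := hpos z hz
  obtain ⟨M, hM⟩ : ∃ M, M = h z * (1 + C₁ * (u - l) / l) * (C₁ / l) := ⟨_, rfl⟩
  have key : ∀ y ∈ Ioc l u, |h y - h z| ≤ M * |y - z| := by
    intro y hy
    have hy0 : 0 < y := hl.trans hy.1
    have hhy := hpos y hy
    have h1 := hd z hz y hy
    have h2 := hd y hy z hz
    rw [div_le_iff₀ hhz] at h1
    rw [div_le_iff₀ hhy] at h2
    have e1 : C₁ * |z - y| / z ≤ C₁ / l * |y - z| := by
      rw [abs_sub_comm z y, mul_div_right_comm]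
      gcongr
      exact hz.1.le
    have e2 : C₁ * |y - z| / y ≤ C₁ / l * |y - z| := by
      rw [mul_div_right_comm]
      gcongr
      exact hy.1.le
    have e3 : |y - z| ≤ u - l := by
      rw [abs_le]; constructor <;> linarith [hy.1, hy.2, hz.1, hz.2]
    have e4 : C₁ / l * |y - z| ≤ C₁ * (u - l) / l := by
      rw [mul_div_right_comm]; gcongr
    have n0 : 0 ≤ C₁ / l * |y - z| := by positivity
    have e5 : h y ≤ h z * (1 + C₁ * (u - l) / l) := by
      nlinarith
    have e6 : h z ≤ h z * (1 + C₁ * (u - l) / l) := by nlinarith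
    rw [hM, mul_assoc, abs_le]
    constructor
    · nlinarith
    · nlinarith
  have : Filter.Tendsto (fun y => M * |y - z|) (nhdsWithin z (Ioc l u)) (nhds 0) := by
    have : Continuous (fun y => M * |y - z|) := by fun_prop
    have h := this.tendsto z
    simp only [sub_self, abs_zero, mul_zero] at h
    exact h.mono_left nhdsWithin_le_nhds
  rw [ContinuousWithinAt, tendsto_iff_dist_tendsto_zero]
  refine squeeze_zero' (Filter.Eventually.of_forall fun _ => dist_nonneg) ?_ this
  filter_upwards [self_mem_nhdsWithin] with y hy
  rw [Real.dist_eq]; exact key y hy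

lemma F_diff {μ : Measure ℝ} [IsProbabilityMeasure μ] {x y : ℝ} (hxy : x ≤ y) :
    μ.real (Iic y) - μ.real (Iic x) = μ.real (Ioc x y) := by
  rw [← Iic_union_Ioc_eq_Iic hxy, measureReal_union _ measurableSet_Ioc]
  · ring
  · rw [Set.disjoint_left]; intro t ht ht'; exact absurd ht (not_le.2 ht'.1)

lemma F_bd {h : ℝ → ℝ} {μ : Measure ℝ} [IsProbabilityMeasure μ]
    (hμ : μ = (volume.restrict (Icc (0:ℝ) 1)).withDensity (fun x => ENNReal.ofReal (h x)))
    {x y m M : ℝ} (hx : 0 ≤ x) (hxy : x ≤ y) (hy : y ≤ 1) (hm : 0 ≤ M)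
    (hb : ∀ t ∈ Ioc x y, m ≤ h t ∧ h t ≤ M) :
    m * (y - x) ≤ μ.real (Iic y) - μ.real (Iic x) ∧
    μ.real (Iic y) - μ.real (Iic x) ≤ M * (y - x) := by
  rw [F_diff hxy]
  have e : μ (Ioc x y) = ∫⁻ t in Ioc x y, ENNReal.ofReal (h t) := by
    rw [hμ, withDensity_apply _ measurableSet_Ioc, Measure.restrict_restrict measurableSet_Ioc]
    rw [inter_eq_left.2]
    intro t ht; exact ⟨hx.trans ht.1.le, ht.2.trans hy⟩
  have u1 : μ (Ioc x y) ≤ ENNReal.ofReal (M * (y - x)) := by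
    rw [e, ENNReal.ofReal_mul hm, ← Real.volume_Ioc, ← setLIntegral_const]
    apply setLIntegral_mono measurable_const
    intro t ht; exact ENNReal.ofReal_le_ofReal (hb t ht).2
  have l1 : ENNReal.ofReal m * ENNReal.ofReal (y - x) ≤ μ (Ioc x y) := by
    rw [e, ← Real.volume_Ioc, ← setLIntegral_const]
    apply setLIntegral_mono' measurableSet_Ioc
    intro t ht; exact ENNReal.ofReal_le_ofReal (hb t ht).1
  constructor
  · rcases le_total m 0 with h0 | h0
    · have : 0 ≤ μ.real (Ioc x y) := measureReal_nonneg
      nlinarith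
    · rw [← ENNReal.ofReal_mul h0] at l1
      exact (ENNReal.ofReal_le_iff_le_toReal (measure_ne_top _ _)).1 l1
  · exact ENNReal.toReal_le_of_le_ofReal (mul_nonneg hm (by linarith)) u1

lemma F_deriv {h : ℝ → ℝ} {μ : Measure ℝ} [IsProbabilityMeasure μ]
    (hμ : μ = (volume.restrict (Icc (0:ℝ) 1)).withDensity (fun x => ENNReal.ofReal (h x)))
    {s : Set ℝ} (hs : s.OrdConnected) (hs1 : s ⊆ Icc 0 1) {z : ℝ} (hz : z ∈ s) (hhz : 0 < h z)
    (hc : ContinuousWithinAt h s z) :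
    HasDerivWithinAt (fun y => μ.real (Iic y)) (h z) s z := by
  rw [hasDerivWithinAt_iff_isLittleO, Asymptotics.isLittleO_iff]
  intro ε hε
  obtain ⟨δ, hδ, hd⟩ := Metric.continuousWithinAt_iff.1 hc ε hε
  filter_upwards [self_mem_nhdsWithin, mem_nhdsWithin_of_mem_nhds (Metric.ball_mem_nhds z hδ)]
    with y hy hyd
  rw [Metric.mem_ball, Real.dist_eq] at hyd
  have hd' : ∀ t ∈ s, |t - z| < δ → h z - ε ≤ h t ∧ h t ≤ h z + ε := by
    intro t ht htd
    have := hd ht (by rwa [Real.dist_eq])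
    rw [Real.dist_eq, abs_lt] at this
    constructor <;> linarith
  simp only [smul_eq_mul, Real.norm_eq_abs]
  rw [abs_lt] at hyd
  rcases le_total y z with hyz | hyz
  · obtain ⟨h1, h2⟩ := F_bd hμ (hs1 hy).1 hyz (hs1 hz).2 (m := h z - ε) (M := h z + ε)
      (by positivity) (fun t ht => hd' t (hs.out hy hz ⟨ht.1.le, ht.2⟩)
        (by rw [abs_lt]; constructor <;> linarith [ht.1, ht.2]))
    rw [abs_of_nonpos (by linarith : y - z ≤ 0), abs_le]
    constructor <;> nlinarith
  · obtain ⟨h1, h2⟩ := F_bd hμ (hs1 hz).1 hyz (hs1 hy).2 (m := h z - ε) (M := h z + ε)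
      (by positivity) (fun t ht => hd' t (hs.out hz hy ⟨ht.1.le, ht.2⟩)
        (by rw [abs_lt]; constructor <;> linarith [ht.1, ht.2]))
    rw [abs_of_nonneg (by linarith : 0 ≤ y - z), abs_le]
    constructor <;> nlinarith

lemma F_inv {α : ℝ} {T T' a b h : ℝ → ℝ} {Mx : ℝ} (B : Brn α T T' a b Mx)
    {μ : Measure ℝ} [IsProbabilityMeasure μ]
    (hμ : μ = (volume.restrict (Icc (0:ℝ) 1)).withDensity (fun x => ENNReal.ofReal (h x)))
    (hinv : MeasurePreserving T μ μ) :
    (StrictMonoOn T (Icc (1/2:ℝ) 1) → ∀ y ∈ Ioo (0:ℝ) 1, μ.real (Iic y)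
      = μ.real (Iic (a y)) + (μ.real (Iic (b y)) - μ.real (Iic (1/2)))) ∧
    (StrictAntiOn T (Icc (1/2:ℝ) 1) → ∀ y ∈ Ioo (0:ℝ) 1, μ.real (Iic y)
      = μ.real (Iic (a y)) + (μ.real (Iic 1) - μ.real (Iic (b y)))) := by
  have hac : μ ≪ volume.restrict (Icc (0:ℝ) 1) := by
    rw [hμ]; exact withDensity_absolutelyContinuous _ _
  have hI : ∀ᵐ x ∂μ, x ∈ Icc (0:ℝ) 1 := hac.ae_le (ae_restrict_mem measurableSet_Icc)
  have hpt : ∀ c : ℝ, ∀ᵐ x ∂μ, x ≠ c := fun c =>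
    (hac.trans Measure.restrict_le_self.absolutelyContinuous).ae_le (Measure.ae_ne volume c)
  have hF : ∀ y, μ.real (Iic y) = μ.real (T ⁻¹' Iic y) := by
    intro y
    rw [measureReal_def, measureReal_def, hinv.measure_preimage measurableSet_Iic.nullMeasurableSet]
  constructor
  · intro hm y hy
    have hbm := B.b_mem y hy
    have ham := B.a_mem y hy
    rw [F_diff hbm.1.le, ← measureReal_union _ measurableSet_Ioc, hF]
    · apply measureReal_congr
      filter_upwards [hI, hpt (1/2), hpt (b y)] with x hx h1 h2
      change (x ∈ T ⁻¹' Iic y) = (x ∈ Iic (a y) ∪ Ioc (1/2) (b y))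
      simp only [mem_preimage, mem_Iic, mem_union, mem_Ioc, eq_iff_iff]
      rcases lt_or_gt_of_ne h1 with h | h
      · rw [← B.a_mono y hy x ⟨hx.1, h⟩]
        constructor
        · exact Or.inl
        · rintro (h' | h')
          · exact h'
          · linarith [h'.1]
      · nth_rewrite 1 [← B.Tb y hy]
        rw [hm.le_iff_le ⟨h.le, hx.2⟩ ⟨hbm.1.le, hbm.2.le⟩]
        constructor
        · exact fun h' => Or.inr ⟨h, h'⟩
        · rintro (h' | h')
          · linarith [ham.2]
          · exact h'.2
    · rw [Set.disjoint_left]; intro t ht ht'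
      have := ht'.1
      have : t ≤ a y := ht
      linarith [ham.2]
  · intro hm y hy
    have hbm := B.b_mem y hy
    have ham := B.a_mem y hy
    rw [F_diff hbm.2.le, ← measureReal_union _ measurableSet_Ioc, hF]
    · apply measureReal_congr
      filter_upwards [hI, hpt (1/2), hpt (b y)] with x hx h1 h2
      change (x ∈ T ⁻¹' Iic y) = (x ∈ Iic (a y) ∪ Ioc (b y) 1)
      simp only [mem_preimage, mem_Iic, mem_union, mem_Ioc, eq_iff_iff]
      rcases lt_or_gt_of_ne h1 with h | h
      · rw [← B.a_mono y hy x ⟨hx.1, h⟩]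
        constructor
        · exact Or.inl
        · rintro (h' | h')
          · exact h'
          · linarith [h'.1, hbm.1]
      · nth_rewrite 1 [← B.Tb y hy]
        rw [hm.le_iff_ge ⟨h.le, hx.2⟩ ⟨hbm.1.le, hbm.2.le⟩]
        constructor
        · exact fun h' => Or.inr ⟨lt_of_le_of_ne h' h2.symm, hx.2⟩
        · rintro (h' | h')
          · linarith [ham.2]
          · exact h'.1.le
    · rw [Set.disjoint_left]; intro t ht ht'
      have := ht'.1
      have : t ≤ a y := ht
      linarith [ham.2, hbm.1]

lemma inv_deriv {T g : ℝ → ℝ} {d z : ℝ} (hz : z ∈ Ioo (0:ℝ) 1)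
    (hg : ∀ z ∈ Ioo (0:ℝ) 1, ∀ z' ∈ Ioo (0:ℝ) 1, |g z - g z'| ≤ |z - z'|)
    (hT : HasDerivAt T d (g z)) (hd : d ≠ 0) (hTg : ∀ z ∈ Ioo (0:ℝ) 1, T (g z) = z) :
    HasDerivAt g d⁻¹ z := by
  have hn : Ioo (0:ℝ) 1 ∈ nhds z := Ioo_mem_nhds hz.1 hz.2
  apply HasDerivAt.of_local_left_inverse _ hT hd
  · filter_upwards [hn] with y hy using hTg y hy
  · rw [ContinuousAt, tendsto_iff_dist_tendsto_zero]
    have : Filter.Tendsto (fun y => |y - z|) (nhds z) (nhds 0) := by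
      have : Continuous (fun y => |y - z|) := by fun_prop
      have h := this.tendsto z
      simpa using h
    refine squeeze_zero' (Filter.Eventually.of_forall fun _ => dist_nonneg) ?_ this
    filter_upwards [hn] with y hy
    rw [Real.dist_eq]; exact hg y hy z hz

lemma inv_identity {α : ℝ} (hα0 : 0 < α) {T T' a b h : ℝ → ℝ} {Mx : ℝ} (B : Brn α T T' a b Mx)
    {μ : Measure ℝ} (hprob : IsProbabilityMeasure μ)
    (hμ : μ = (volume.restrict (Icc (0:ℝ) 1)).withDensity (fun x => ENNReal.ofReal (h x)))
    (hinv : MeasurePreserving T μ μ)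
    (hT_deriv : ∀ x ∈ Icc (0:ℝ) 1, x ≠ 1/2 → HasDerivAt T (T' x) x)
    (hT_C2 : ContDiffOn ℝ 2 T (Icc (1/2:ℝ) 1))
    (hT_bij : BijOn T (Icc (1/2:ℝ) 1) (Icc (0:ℝ) 1))
    {xpt : ℕ → ℝ} (hx0 : xpt 0 = 1) (hx1 : xpt 1 = 1/2)
    (hxpos : ∀ ℓ, 0 < xpt ℓ) (hxdec : ∀ ℓ, xpt (ℓ + 1) < xpt ℓ)
    (hxpre : ∀ ℓ, 2 ≤ ℓ → xpt ℓ ∈ Ioo (0:ℝ) (1/2) ∧ T (xpt ℓ) = xpt (ℓ - 1))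
    (hat : ∀ z ∈ Ioc (0:ℝ) 1, ∃ ℓ, z ∈ Ioc (xpt (ℓ+1)) (xpt ℓ))
    (hpos : ∀ x ∈ Ioc (0:ℝ) 1, 0 < h x)
    {C₁ : ℝ} (hC₁ : 0 < C₁)
    (hdist1 : ∀ ℓ : ℕ, ∀ y ∈ Ioc (xpt (ℓ + 1)) (xpt ℓ), ∀ yt ∈ Ioc (xpt (ℓ + 1)) (xpt ℓ),
      h yt / h y ≤ 1 + C₁ * |y - yt| / y) :
    ∀ z ∈ Ioo (0:ℝ) 1, h z = h (a z) / T' (a z) + h (b z) / |T' (b z)| := by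
  intro z hz
  have hle1 : ∀ ℓ, xpt ℓ ≤ 1 := by
    intro ℓ; rw [← hx0]; exact antitone_nat_of_succ_le (fun n => (hxdec n).le) (Nat.zero_le ℓ)
  have hsub : ∀ ℓ, Ioc (xpt (ℓ+1)) (xpt ℓ) ⊆ Ioc 0 1 := fun ℓ =>
    Ioc_subset_Ioc (hxpos _).le (hle1 _)
  have hFat : ∀ ℓ, ∀ y ∈ Ioc (xpt (ℓ+1)) (xpt ℓ),
      HasDerivWithinAt (fun y => μ.real (Iic y)) (h y) (Ioc (xpt (ℓ+1)) (xpt ℓ)) y := by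
    intro ℓ y hy
    exact F_deriv hμ ordConnected_Ioc ((hsub ℓ).trans Ioc_subset_Icc_self) hy
      (hpos y (hsub ℓ hy)) (h_cont (hxpos _) hC₁ (fun t ht => hpos t (hsub ℓ ht)) (hdist1 ℓ) y hy)
  obtain ⟨ℓ, hℓ⟩ := hat z ⟨hz.1, hz.2.le⟩
  have ham := B.a_mem z hz
  have hbm := B.b_mem z hz
  have sS : Ioc (xpt (ℓ+1)) z ⊆ Ioc (xpt (ℓ+1)) (xpt ℓ) := Ioc_subset_Ioc le_rfl hℓ.2
  have sI : Ioc (xpt (ℓ+1)) z ⊆ Ioo 0 1 := fun t ht => ⟨(hxpos _).trans ht.1, ht.2.trans_lt hz.2⟩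
  have zS : z ∈ Ioc (xpt (ℓ+1)) z := ⟨hℓ.1, le_rfl⟩
  have D1 := (hFat ℓ z hℓ).mono sS
  have hTa0 : T' (a z) ≠ 0 := by
    rw [B.T'a z hz]
    have : 0 < (2 * a z) ^ α := Real.rpow_pos_of_pos (by linarith [ham.1]) _
    positivity
  have da := inv_deriv hz B.a_lip (hT_deriv _ ⟨ham.1.le, by linarith [ham.2]⟩ ham.2.ne) hTa0 B.Ta
  have hTb1 := B.T'b1 z hz
  have hTb0 : T' (b z) ≠ 0 := by
    intro h0; rw [h0, abs_zero] at hTb1; linarith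
  have dTb := hT_deriv (b z) ⟨by linarith [hbm.1], hbm.2.le⟩ hbm.1.ne'
  have db := inv_deriv hz B.b_lip dTb hTb0 B.Tb
  have D2 := (hFat (ℓ+1) (a z) (a_atom B hx1 hxpre ℓ z hz hℓ)).comp z
    (da.hasDerivWithinAt (s := Ioc (xpt (ℓ+1)) z))
    (fun t ht => a_atom B hx1 hxpre ℓ t (sI ht) (sS ht))
  have D3 := (hFat 0 (b z) (by rw [hx0, zero_add, hx1]; exact ⟨hbm.1, hbm.2.le⟩)).comp z
    (db.hasDerivWithinAt (s := Ioc (xpt (ℓ+1)) z))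
    (fun t ht => by
      have := B.b_mem t (sI ht)
      rw [hx0, zero_add, hx1]; exact ⟨this.1, this.2.le⟩)
  have hU := uniqueDiffOn_Ioc (xpt (ℓ+1)) z z zS
  have hUb : UniqueDiffWithinAt ℝ (Icc (1/2:ℝ) 1) (b z) :=
    uniqueDiffOn_Icc (by norm_num) _ ⟨hbm.1.le, hbm.2.le⟩
  have hdw := dTb.hasDerivWithinAt.derivWithin hUb
  rcases right_mono hT_C2 hT_bij with ⟨hm, -, -⟩ | ⟨hm, -, -⟩
  · have hsg : 0 ≤ T' (b z) := by rw [← hdw]; exact hm.monotoneOn.derivWithin_nonneg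
    have D4 := D2.add (D3.sub_const (μ.real (Iic (1/2))))
    have D5 := D4.congr_of_mem (f₁ := fun y => μ.real (Iic y))
      (fun y hy => (F_inv B hμ hinv).1 hm y (sI hy)) zS
    rw [hU.eq_deriv _ D1 D5, abs_of_nonneg hsg]
    rfl
  · have hsg : T' (b z) ≤ 0 := by rw [← hdw]; exact hm.antitoneOn.derivWithin_nonpos
    have D4 := D2.add (D3.const_sub (μ.real (Iic 1)))
    have D5 := D4.congr_of_mem (f₁ := fun y => μ.real (Iic y))
      (fun y hy => (F_inv B hμ hinv).2 hm y (sI hy)) zS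
    rw [hU.eq_deriv _ D1 D5, abs_of_nonpos hsg, div_neg]
    rfl

structure Dat (α : ℝ) (T T' a b h p : ℝ → ℝ) (Mx c₁ c₂ C₁ : ℝ) (xpt : ℕ → ℝ) : Prop where
  B : Brn α T T' a b Mx
  hα0 : 0 < α
  hα7 : 7 * α < 1
  hx0 : xpt 0 = 1
  hx1 : xpt 1 = 1/2
  hxpos : ∀ ℓ, 0 < xpt ℓ
  hxdec : ∀ ℓ, xpt (ℓ + 1) < xpt ℓ
  hxpre : ∀ ℓ, 2 ≤ ℓ → xpt ℓ ∈ Ioo (0:ℝ) (1/2) ∧ T (xpt ℓ) = xpt (ℓ - 1)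
  hx2 : ∀ ℓ, xpt ℓ ≤ 2 * xpt (ℓ + 1)
  hc₁ : 0 < c₁
  hc₂ : 0 < c₂
  hdens : ∀ x ∈ Ioc (0:ℝ) 1, c₁ * x ^ (-α) ≤ h x ∧ h x ≤ c₂ * x ^ (-α)
  hC₁ : 0 < C₁
  hdist1 : ∀ ℓ : ℕ, ∀ y ∈ Ioc (xpt (ℓ + 1)) (xpt ℓ), ∀ yt ∈ Ioc (xpt (ℓ + 1)) (xpt ℓ),
      h yt / h y ≤ 1 + C₁ * |y - yt| / y
  hd2 : ∀ z ∈ Ioo (0:ℝ) 1, ∀ z' ∈ Ioo (0:ℝ) 1,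
    (∃ ℓ, z ∈ Ioc (xpt (ℓ+1)) (xpt ℓ) ∧ z' ∈ Ioc (xpt (ℓ+1)) (xpt ℓ)) →
    |T' (b z')| / |T' (b z)| ≤ 1 + C₁ * |z - z'| / z
  hp : ∀ z, p z = h (a z) / (h z * T' (a z))
  hq : ∀ z ∈ Ioo (0:ℝ) 1, 1 - p z = h (b z) / (h z * |T' (b z)|)

def SAr (xpt : ℕ → ℝ) (z z' : ℝ) : Prop :=
  ∃ ℓ, z ∈ Ioc (xpt (ℓ+1)) (xpt ℓ) ∧ z' ∈ Ioc (xpt (ℓ+1)) (xpt ℓ)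

open Classical in
noncomputable def Gf (z : ℝ) : ℝ := if z ≤ 1/2 then Real.log z else 2 * z

noncomputable def rhof (z z' : ℝ) : ℝ := |Gf z - Gf z'|

lemma abs_sub_le_log {z z' : ℝ} (hz : 0 < z) (hz' : 0 < z') :
    |z - z'| ≤ max z z' * |Real.log z - Real.log z'| := by
  have key : ∀ z z' : ℝ, 0 < z → z ≤ z' → z' - z ≤ z' * (Real.log z' - Real.log z) := by
    intro z z' hz h
    have hz' : 0 < z' := hz.trans_le h
    have := Real.log_le_sub_one_of_pos (div_pos hz hz')
    rw [Real.log_div hz.ne' hz'.ne'] at this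
    have e : z' * (z / z') = z := by field_simp
    nlinarith
  rcases le_total z z' with h | h
  · rw [max_eq_right h, abs_sub_comm, abs_of_nonneg (by linarith), abs_sub_comm,
      abs_of_nonneg (sub_nonneg.2 (Real.log_le_log hz h))]
    exact key z z' hz h
  · rw [max_eq_left h, abs_of_nonneg (by linarith),
      abs_of_nonneg (sub_nonneg.2 (Real.log_le_log hz' h))]
    exact key z' z hz' h

lemma log_le_abs_sub {z z' : ℝ} (hz : 1/2 ≤ z) (hz' : 1/2 ≤ z') :
    |Real.log z - Real.log z'| ≤ 2 * |z - z'| := by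
  have key : ∀ z z' : ℝ, 1/2 ≤ z → z ≤ z' → (Real.log z' - Real.log z) ≤ 2 * (z' - z) := by
    intro z z' hz h
    have hz0 : 0 < z := by linarith
    have hz' : 0 < z' := hz0.trans_le h
    have := Real.log_le_sub_one_of_pos (div_pos hz' hz0)
    rw [Real.log_div hz'.ne' hz0.ne'] at this
    have e : z' / z - 1 ≤ 2 * (z' - z) := by
      rw [div_sub_one hz0.ne', div_le_iff₀ hz0]; nlinarith
    linarith
  rcases le_total z z' with h | h
  · rw [abs_sub_comm z, abs_of_nonneg (by linarith : 0 ≤ z' - z), abs_sub_comm,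
      abs_of_nonneg (sub_nonneg.2 (Real.log_le_log (by linarith) h))]
    exact key z z' hz h
  · rw [abs_of_nonneg (by linarith : 0 ≤ z - z'),
      abs_of_nonneg (sub_nonneg.2 (Real.log_le_log (by linarith) h))]
    exact key z' z hz' h

section
variable {α : ℝ} {T T' a b h p : ℝ → ℝ} {Mx c₁ c₂ C₁ : ℝ} {xpt : ℕ → ℝ}

lemma SA_cases (D : Dat α T T' a b h p Mx c₁ c₂ C₁ xpt) {z z' : ℝ} (hS : SAr xpt z z') :
    0 < z ∧ 0 < z' ∧ z ≤ 2 * z' ∧ z' ≤ 2 * z ∧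
    ((z ≤ 1/2 ∧ z' ≤ 1/2) ∨ (1/2 < z ∧ 1/2 < z' ∧ z ≤ 1 ∧ z' ≤ 1)) := by
  obtain ⟨ℓ, h1, h2⟩ := hS
  have p1 := D.hxpos (ℓ+1)
  have := D.hx2 ℓ
  refine ⟨by linarith [h1.1], by linarith [h2.1], by linarith [h1.2, h2.1],
    by linarith [h1.1, h2.2], ?_⟩
  rcases Nat.eq_zero_or_pos ℓ with h0 | h0
  · subst h0
    rw [D.hx0, zero_add, D.hx1] at h1 h2
    exact Or.inr ⟨h1.1, h2.1, h1.2, h2.2⟩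
  · left
    have : xpt ℓ ≤ 1/2 := by
      rw [← D.hx1]; exact antitone_nat_of_succ_le (fun n => (D.hxdec n).le) h0
    exact ⟨h1.2.trans this, h2.2.trans this⟩

lemma rho_facts (D : Dat α T T' a b h p Mx c₁ c₂ C₁ xpt) {z z' : ℝ} (hS : SAr xpt z z') :
    |Real.log z - Real.log z'| ≤ rhof z z' ∧ rhof z z' ≤ 1 ∧ |z - z'| ≤ rhof z z' ∧
    |z - z'| ≤ 2 * z * rhof z z' := by
  obtain ⟨h0, h0', h1, h2, h3⟩ := SA_cases D hS
  have hl := abs_sub_le_log h0 h0'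
  have hm : max z z' ≤ 2 * z := max_le (by linarith) h2
  have r0 : 0 ≤ |Real.log z - Real.log z'| := abs_nonneg _
  rcases h3 with ⟨h3, h4⟩ | ⟨h3, h4, h5, h6⟩
  · have e : rhof z z' = |Real.log z - Real.log z'| := by
      unfold rhof Gf; rw [if_pos h3, if_pos h4]
    rw [e]
    refine ⟨le_rfl, ?_, ?_, ?_⟩
    · have hlog : ∀ x y : ℝ, 0 < x → 0 < y → x ≤ 2 * y → Real.log x - Real.log y ≤ 1 := by
        intro x y hx hy hxy
        have := Real.log_le_log hx hxy
        rw [Real.log_mul (by norm_num) hy.ne'] at this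
        linarith [Real.log_two_lt_d9]
      rw [abs_le]
      constructor
      · linarith [hlog z' z h0' h0 h2]
      · exact hlog z z' h0 h0' h1
    · have : max z z' ≤ 1 := max_le (by linarith) (by linarith)
      nlinarith
    · nlinarith
  · have e : rhof z z' = 2 * |z - z'| := by
      unfold rhof Gf; rw [if_neg (by linarith), if_neg (by linarith), ← mul_sub, abs_mul]
      norm_num
    rw [e]
    have n0 : 0 ≤ |z - z'| := abs_nonneg _
    refine ⟨log_le_abs_sub h3.le h4.le, ?_, by linarith, by nlinarith⟩
    rw [show (1:ℝ) = 2 * (1/2) by norm_num]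
    gcongr
    rw [abs_le]; constructor <;> linarith

lemma u_facts (D : Dat α T T' a b h p Mx c₁ c₂ C₁ xpt) {z : ℝ} (hz : z ∈ Ioo (0:ℝ) 1) :
    0 < (2 * a z) ^ α ∧ (2 * a z) ^ α ≤ 1 ∧ z ^ α ≤ (2 * a z) ^ α ∧ a z ≤ z := by
  have ha := D.B.a_mem z hz
  have e := D.B.za z hz
  have h1 : 0 < (2 * a z) ^ α := Real.rpow_pos_of_pos (by linarith [ha.1]) _
  have h2 : (2 * a z) ^ α ≤ 1 :=
    Real.rpow_le_one (by linarith [ha.1]) (by linarith [ha.2]) D.hα0.le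
  have ha1 := ha.1
  refine ⟨h1, h2, Real.rpow_le_rpow hz.1.le ?_ D.hα0.le, ?_⟩ <;> nlinarith

lemma h_pos (D : Dat α T T' a b h p Mx c₁ c₂ C₁ xpt) {z : ℝ} (hz : z ∈ Ioc (0:ℝ) 1) : 0 < h z :=
  (mul_pos D.hc₁ (Real.rpow_pos_of_pos hz.1 _)).trans_le (D.hdens z hz).1

lemma hb_facts (D : Dat α T T' a b h p Mx c₁ c₂ C₁ xpt) {z : ℝ} (hz : z ∈ Ioo (0:ℝ) 1) :
    c₁ ≤ h (b z) ∧ h (b z) ≤ 2 * c₂ ∧ 1 ≤ 2 * b z ^ α ∧ b z ^ α ≤ 1 := by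
  have hb := D.B.b_mem z hz
  have hb0 : 0 < b z := by linarith [hb.1]
  obtain ⟨h1, h2⟩ := D.hdens (b z) ⟨hb0, hb.2.le⟩
  have hα1 : α ≤ 1 := by linarith [D.hα7, D.hα0]
  have h4 : b z ^ α ≤ 1 := Real.rpow_le_one hb0.le hb.2.le D.hα0.le
  have h3 : 1/2 ≤ b z ^ α := by
    calc (1/2:ℝ) ≤ b z := hb.1.le
      _ = b z ^ (1:ℝ) := (Real.rpow_one _).symm
      _ ≤ _ := Real.rpow_le_rpow_of_exponent_ge hb0 hb.2.le hα1
  rw [Real.rpow_neg hb0.le] at h1 h2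
  have hc1 := D.hc₁
  have hc2 := D.hc₂
  refine ⟨?_, ?_, by linarith, h4⟩
  · refine le_trans ?_ h1
    rw [← div_eq_mul_inv, le_div_iff₀ (by linarith)]; nlinarith
  · refine h2.trans ?_
    rw [← div_eq_mul_inv, div_le_iff₀ (by linarith)]; nlinarith

lemma hz_facts (D : Dat α T T' a b h p Mx c₁ c₂ C₁ xpt) {z : ℝ} (hz : z ∈ Ioc (0:ℝ) 1) :
    c₁ ≤ h z * z ^ α ∧ h z * z ^ α ≤ c₂ := by
  obtain ⟨h1, h2⟩ := D.hdens z hz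
  rw [Real.rpow_neg hz.1.le, ← div_eq_mul_inv] at h1 h2
  have : 0 < z ^ α := Real.rpow_pos_of_pos hz.1 _
  exact ⟨(div_le_iff₀ this).1 h1, (le_div_iff₀ this).1 h2⟩

lemma p_lower (D : Dat α T T' a b h p Mx c₁ c₂ C₁ xpt) {z : ℝ} (hz : z ∈ Ioo (0:ℝ) 1) :
    c₁ / (3 * c₂) ≤ p z := by
  have ha := D.B.a_mem z hz
  obtain ⟨u0, u1, -, haz⟩ := u_facts D hz
  have hzI : z ∈ Ioc (0:ℝ) 1 := ⟨hz.1, hz.2.le⟩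
  have haI : a z ∈ Ioc (0:ℝ) 1 := ⟨ha.1, by linarith [ha.2]⟩
  have h1 := (hz_facts D hzI).2
  have h2 := (hz_facts D haI).1
  have hhz := h_pos D hzI
  have hha := h_pos D haI
  have hα := D.hα7
  have hα0 := D.hα0
  have hc1 := D.hc₁
  have hc2 := D.hc₂
  have hT : 0 < T' (a z) ∧ T' (a z) ≤ 3 := by
    rw [D.B.T'a z hz]; constructor
    · positivity
    · nlinarith
  have hpw : a z ^ α ≤ z ^ α := Real.rpow_le_rpow ha.1.le haz hα0.le
  have hz0 : 0 < z ^ α := Real.rpow_pos_of_pos hz.1 _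
  rw [D.hp, div_le_div_iff₀ (by positivity) (mul_pos hhz hT.1)]
  have e1 : c₁ ≤ h (a z) * z ^ α := h2.trans (by gcongr)
  calc c₁ * (h z * T' (a z)) ≤ (h (a z) * z ^ α) * (h z * 3) := by
        gcongr; exact mul_nonneg hhz.le hT.1.le; exact hT.2
    _ = h (a z) * (3 * (h z * z ^ α)) := by ring
    _ ≤ h (a z) * (3 * c₂) := by gcongr

lemma q_bounds (D : Dat α T T' a b h p Mx c₁ c₂ C₁ xpt) {z : ℝ} (hz : z ∈ Ioo (0:ℝ) 1) :
    c₁ / (c₂ * Mx) * z ^ α ≤ 1 - p z ∧ 1 - p z ≤ (2 * c₂ / c₁) * z ^ α := by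
  have hzI : z ∈ Ioc (0:ℝ) 1 := ⟨hz.1, hz.2.le⟩
  obtain ⟨h1, h2⟩ := hz_facts D hzI
  obtain ⟨h3, h4, -, -⟩ := hb_facts D hz
  have hhz := h_pos D hzI
  have hc1 := D.hc₁
  have hc2 := D.hc₂
  have hM := D.B.hMx
  have t1 := D.B.T'b1 z hz
  have t2 := D.B.T'b2 z hz
  have hz0 : 0 < z ^ α := Real.rpow_pos_of_pos hz.1 _
  have ht0 : 0 < |T' (b z)| := by linarith
  rw [D.hq z hz]
  constructor
  · rw [div_mul_eq_mul_div, div_le_div_iff₀ (by positivity) (by positivity)]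
    calc c₁ * z ^ α * (h z * |T' (b z)|) = c₁ * ((h z * z ^ α) * |T' (b z)|) := by ring
      _ ≤ h (b z) * (c₂ * Mx) := by gcongr; linarith
  · rw [div_mul_eq_mul_div, div_le_div_iff₀ (by positivity) (by positivity)]
    calc h (b z) * c₁ ≤ 2 * c₂ * ((h z * z ^ α) * 1) := by
          rw [mul_one]; gcongr
      _ ≤ 2 * c₂ * ((h z * z ^ α) * |T' (b z)|) := by gcongr
      _ = _ := by ring

lemma q_ratio (D : Dat α T T' a b h p Mx c₁ c₂ C₁ xpt) {z z' : ℝ} (hz : z ∈ Ioo (0:ℝ) 1)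
    (hz' : z' ∈ Ioo (0:ℝ) 1) (hS : SAr xpt z z') :
    1 - p z ≤ (1 - p z') * (1 + 2 * C₁ * rhof z z') ^ 3 := by
  obtain ⟨-, r2, r3, r4⟩ := rho_facts D hS
  have hzI : z ∈ Ioc (0:ℝ) 1 := ⟨hz.1, hz.2.le⟩
  have hzI' : z' ∈ Ioc (0:ℝ) 1 := ⟨hz'.1, hz'.2.le⟩
  have hb := D.B.b_mem z hz
  have hb' := D.B.b_mem z' hz'
  have hbI : b z ∈ Ioc (0:ℝ) 1 := ⟨by linarith [hb.1], hb.2.le⟩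
  have hbI' : b z' ∈ Ioc (0:ℝ) 1 := ⟨by linarith [hb'.1], hb'.2.le⟩
  have p1 := h_pos D hzI
  have p2 := h_pos D hzI'
  have p3 := h_pos D hbI
  have p4 := h_pos D hbI'
  have t1 : 0 < |T' (b z)| := by linarith [D.B.T'b1 z hz]
  have t2 : 0 < |T' (b z')| := by linarith [D.B.T'b1 z' hz']
  have hC := D.hC₁
  have hz0 := hz.1
  have r0 : 0 ≤ rhof z z' := abs_nonneg _
  have E0 : C₁ * |z - z'| / z ≤ 2 * C₁ * rhof z z' := by
    rw [div_le_iff₀ hz0]; nlinarith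
  have E1 : h (b z) ≤ (1 + 2 * C₁ * rhof z z') * h (b z') := by
    have := D.hdist1 0 (b z') (by rw [D.hx0, zero_add, D.hx1]; exact ⟨hb'.1, hb'.2.le⟩)
      (b z) (by rw [D.hx0, zero_add, D.hx1]; exact ⟨hb.1, hb.2.le⟩)
    rw [div_le_iff₀ p4] at this
    refine this.trans ?_
    gcongr
    have hl := D.B.b_lip z' hz' z hz
    rw [abs_sub_comm z' z] at hl
    rw [div_le_iff₀ hbI'.1]
    have : |b z' - b z| ≤ rhof z z' := hl.trans r3
    have : C₁ * |b z' - b z| ≤ C₁ * rhof z z' := by gcongr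
    have : 0 ≤ C₁ * rhof z z' := by positivity
    nlinarith [hb'.1]
  have E2 : h z' ≤ (1 + 2 * C₁ * rhof z z') * h z := by
    obtain ⟨ℓ, l1, l2⟩ := hS
    have := D.hdist1 ℓ z l1 z' l2
    rw [div_le_iff₀ p1] at this
    refine this.trans ?_
    gcongr
  have E3 : |T' (b z')| ≤ (1 + 2 * C₁ * rhof z z') * |T' (b z)| := by
    have := D.hd2 z hz z' hz' hS
    rw [div_le_iff₀ t1] at this
    refine this.trans ?_
    gcongr
  rw [D.hq z hz, D.hq z' hz', div_mul_eq_mul_div, div_le_div_iff₀ (by positivity) (by positivity)]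
  calc h (b z) * (h z' * |T' (b z')|) ≤ ((1 + 2 * C₁ * rhof z z') * h (b z')) *
        (((1 + 2 * C₁ * rhof z z') * h z) * ((1 + 2 * C₁ * rhof z z') * |T' (b z)|)) := by
        gcongr
    _ = _ := by ring

lemma SA_symm {z z' : ℝ} (hS : SAr xpt z z') : SAr xpt z' z := by
  obtain ⟨ℓ, h1, h2⟩ := hS; exact ⟨ℓ, h2, h1⟩

lemma rho_symm (z z' : ℝ) : rhof z z' = rhof z' z := abs_sub_comm _ _

lemma q_diff1 (D : Dat α T T' a b h p Mx c₁ c₂ C₁ xpt) {z z' : ℝ} (hz : z ∈ Ioo (0:ℝ) 1)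
    (hz' : z' ∈ Ioo (0:ℝ) 1) (hS : SAr xpt z z') :
    (1 - p z) - (1 - p z') ≤
      (2 * c₂ / c₁) * 2 * (2 * C₁ * (3 + 6 * C₁ + 4 * C₁ ^ 2)) * (min z z') ^ α * rhof z z' := by
  obtain ⟨-, r2, -, -⟩ := rho_facts D hS
  obtain ⟨-, -, h1, h2, -⟩ := SA_cases D hS
  have r0 : 0 ≤ rhof z z' := abs_nonneg _
  have hC := D.hC₁
  have hc1 := D.hc₁
  have hc2 := D.hc₂
  have hr := q_ratio D hz hz' hS
  obtain ⟨q1, q2⟩ := q_bounds D hz'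
  have hm0 : 0 < min z z' := lt_min hz.1 hz'.1
  have hα1 : α ≤ 1 := by linarith [D.hα7, D.hα0]
  have e1 : z' ^ α ≤ 2 * (min z z') ^ α := by
    calc z' ^ α ≤ (2 * min z z') ^ α := by
          apply Real.rpow_le_rpow hz'.1.le _ D.hα0.le
          rcases min_choice z z' with h | h <;> rw [h] <;> linarith [hz'.1]
      _ = 2 ^ α * (min z z') ^ α := Real.mul_rpow (by norm_num) hm0.le
      _ ≤ 2 ^ (1:ℝ) * (min z z') ^ α := by
          gcongr; norm_num
      _ = _ := by rw [Real.rpow_one]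
  have hq0 : 0 ≤ 1 - p z' := by
    have : 0 < z' ^ α := Real.rpow_pos_of_pos hz'.1 _
    have := D.B.hMx
    exact le_trans (by positivity) q1
  have e2 : (1 + 2 * C₁ * rhof z z') ^ 3 - 1 ≤ 2 * C₁ * (3 + 6 * C₁ + 4 * C₁ ^ 2) * rhof z z' := by
    obtain ⟨r, hr⟩ : ∃ r, r = rhof z z' := ⟨_, rfl⟩
    rw [← hr] at r0 r2 ⊢
    have : (1 + 2 * C₁ * r) ^ 3 - 1 = 2 * C₁ * (3 + 6 * C₁ * r + 4 * C₁ ^ 2 * r ^ 2) * r := by ring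
    rw [this]
    have : r ^ 2 ≤ 1 := by nlinarith
    have k1 : 6 * C₁ * r ≤ 6 * C₁ := mul_le_of_le_one_right (by positivity) r2
    have k2 : 4 * C₁ ^ 2 * r ^ 2 ≤ 4 * C₁ ^ 2 := mul_le_of_le_one_right (by positivity) this
    have k3 : 3 + 6 * C₁ * r + 4 * C₁ ^ 2 * r ^ 2 ≤ 3 + 6 * C₁ + 4 * C₁ ^ 2 := by linarith
    exact mul_le_mul_of_nonneg_right (mul_le_mul_of_nonneg_left k3 (by positivity)) r0
  calc (1 - p z) - (1 - p z') ≤ (1 - p z') * ((1 + 2 * C₁ * rhof z z') ^ 3 - 1) := by linarith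
    _ ≤ (1 - p z') * (2 * C₁ * (3 + 6 * C₁ + 4 * C₁ ^ 2) * rhof z z') := by gcongr
    _ ≤ ((2 * c₂ / c₁) * (2 * (min z z') ^ α)) * (2 * C₁ * (3 + 6 * C₁ + 4 * C₁ ^ 2) * rhof z z') := by
        gcongr
        exact q2.trans (by gcongr)
    _ = _ := by ring

lemma rho_a1 (D : Dat α T T' a b h p Mx c₁ c₂ C₁ xpt) {z z' : ℝ} (hz : z ∈ Ioo (0:ℝ) 1)
    (hz' : z' ∈ Ioo (0:ℝ) 1) (hS : SAr xpt z z') (hle : z' ≤ z) :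
    |Real.log (a z) - Real.log (a z')| ≤ (1 - α / 8 * z' ^ α) * rhof z z' := by
  obtain ⟨r1, r2, -, -⟩ := rho_facts D hS
  have ha := D.B.a_mem z hz
  have ha' := D.B.a_mem z' hz'
  have hm : a z' ≤ a z := (D.B.a_mono z hz _ ⟨ha'.1.le, ha'.2⟩).2 (by rw [D.B.Ta z' hz']; exact hle)
  obtain ⟨u0, u1, u2, -⟩ := u_facts D hz
  obtain ⟨v0, v1, v2, -⟩ := u_facts D hz'
  have ez := D.B.za z hz
  have ez' := D.B.za z' hz'
  have hα0 := D.hα0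
  have hα1 : α ≤ 1 := by linarith [D.hα7, D.hα0]
  have a0 := ha.1
  have a0' := ha'.1
  obtain ⟨u, hu⟩ : ∃ u, u = (2 * a z) ^ α := ⟨_, rfl⟩
  obtain ⟨v, hv⟩ : ∃ v, v = (2 * a z') ^ α := ⟨_, rfl⟩
  rw [← hu] at u0 u1 u2 ez
  rw [← hv] at v0 v1 v2 ez'
  obtain ⟨Δ, hΔ⟩ : ∃ Δ, Δ = Real.log (a z) - Real.log (a z') := ⟨_, rfl⟩
  have hΔ0 : 0 ≤ Δ := by rw [hΔ]; exact sub_nonneg.2 (Real.log_le_log a0' hm)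
  have huv : v * (1 + α * Δ) ≤ u := by
    have l1 : Real.log u = α * (Real.log 2 + Real.log (a z)) := by
      rw [hu, Real.log_rpow (by positivity), Real.log_mul (by norm_num) a0.ne']
    have l2 : Real.log v = α * (Real.log 2 + Real.log (a z')) := by
      rw [hv, Real.log_rpow (by positivity), Real.log_mul (by norm_num) a0'.ne']
    have l3 : Real.log (u / v) = α * Δ := by
      rw [Real.log_div u0.ne' v0.ne', l1, l2, hΔ]; ring
    have l4 := Real.log_le_sub_one_of_pos (div_pos u0 v0)
    rw [l3] at l4
    have : v * (u / v) = u := by field_simp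
    nlinarith
  have L1 : Real.log z = Real.log (a z) + Real.log (1 + u) := by
    rw [← Real.log_mul a0.ne' (by positivity), ← ez]
  have L2 : Real.log z' = Real.log (a z') + Real.log (1 + v) := by
    rw [← Real.log_mul a0'.ne' (by positivity), ← ez']
  have huv' : v ≤ u := by nlinarith [mul_nonneg v0.le (mul_nonneg hα0.le hΔ0)]
  have hlz : Real.log z - Real.log z' ≤ rhof z z' := (le_abs_self _).trans r1
  have L3 : Real.log (1 + v) ≤ Real.log (1 + u) := Real.log_le_log (by positivity) (by linarith)
  have hΔ1 : Δ ≤ rhof z z' := by linarith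
  obtain ⟨t, ht⟩ : ∃ t, t = v / (1 + v) * (α * Δ) := ⟨_, rfl⟩
  have hlam : v / 2 ≤ v / (1 + v) := by gcongr; linarith
  have hlam1 : v / (1 + v) ≤ 1 := by rw [div_le_one (by positivity)]; linarith
  have ht0 : 0 ≤ t := by rw [ht]; positivity
  have ht1 : t ≤ 1 := by
    rw [ht]
    have : α * Δ ≤ 1 := by nlinarith
    have : 0 ≤ α * Δ := by positivity
    have : 0 ≤ v / (1 + v) := by positivity
    nlinarith
  have L4 : t / 2 ≤ Real.log (1 + u) - Real.log (1 + v) := by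
    have k1 : (1 + v) * (1 + t) ≤ 1 + u := by
      have : (1 + v) * t = v * (α * Δ) := by rw [ht]; field_simp
      nlinarith
    have k2 := Real.log_le_log (by positivity) k1
    rw [Real.log_mul (by positivity) (by positivity)] at k2
    have k3 : t / 2 ≤ Real.log (1 + t) := by
      have := Real.one_sub_inv_le_log_of_pos (show 0 < 1 + t by positivity)
      have e : t / 2 ≤ 1 - (1 + t)⁻¹ := by
        have : 1 - (1 + t)⁻¹ = t / (1 + t) := by field_simp; ring
        rw [this]; gcongr; linarith
      linarith
    linarith
  have hzα : 0 < z' ^ α := Real.rpow_pos_of_pos hz'.1 _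
  have L5 : α / 4 * z' ^ α * Δ ≤ t / 2 := by
    rw [ht]
    have : z' ^ α / 2 ≤ v / (1 + v) := le_trans (by linarith) hlam
    have h2 : z' ^ α / 2 * (α * Δ) ≤ v / (1 + v) * (α * Δ) := by gcongr
    linarith
  have fin : Δ * (1 + α / 4 * z' ^ α) ≤ rhof z z' := by linarith
  rw [← hΔ, abs_of_nonneg hΔ0]
  have x0 : 0 ≤ α / 8 * z' ^ α := by positivity
  have hzα1 : z' ^ α ≤ 1 := v2.trans v1
  have x1 : α / 8 * z' ^ α ≤ 1 / 8 := by
    calc α / 8 * z' ^ α ≤ 1 / 8 * 1 := by gcongr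
      _ = _ := by ring
  obtain ⟨x, hx⟩ : ∃ x, x = α / 8 * z' ^ α := ⟨_, rfl⟩
  rw [← hx] at x0 x1 ⊢
  have fin' : Δ * (1 + 2 * x) ≤ rhof z z' := by rw [hx]; linarith
  have r0 : 0 ≤ rhof z z' := abs_nonneg _
  have : (1 - x) * (Δ * (1 + 2 * x)) ≤ (1 - x) * rhof z z' := by
    apply mul_le_mul_of_nonneg_left fin'; linarith
  have : 0 ≤ Δ * (x * (1 - 2 * x)) := mul_nonneg hΔ0 (mul_nonneg x0 (by linarith))
  nlinarith

lemma cpl_exists (D : Dat α T T' a b h p Mx c₁ c₂ C₁ xpt) :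
    CplSys α (c₁ / (3 * c₂)) (α / 8)
      ((2 * c₂ / c₁) * 2 * (2 * C₁ * (3 + 6 * C₁ + 4 * C₁ ^ 2))) (c₁ / (c₂ * Mx))
      a b p (SAr xpt) rhof := by
  have hC := D.hC₁
  have hc1 := D.hc₁
  have hc2 := D.hc₂
  have hα0 := D.hα0
  have hM := D.B.hMx
  have Gb : ∀ z ∈ Ioo (0:ℝ) 1, ∀ z' ∈ Ioo (0:ℝ) 1, SAr xpt (b z) (b z') := by
    intro z hz z' hz'
    have hb := D.B.b_mem z hz
    have hb' := D.B.b_mem z' hz'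
    refine ⟨0, ?_, ?_⟩ <;> rw [D.hx0, zero_add, D.hx1]
    · exact ⟨hb.1, hb.2.le⟩
    · exact ⟨hb'.1, hb'.2.le⟩
  refine ⟨hα0, by positivity, by positivity, by positivity, by positivity, ?_, ?_,
    fun z hz => p_lower D hz, fun z hz => (q_bounds D hz).1, ?_, ?_, Gb,
    fun z hz z' hz' hS => (rho_facts D hS).2.1, fun z hz z' hz' hS => (rho_facts D hS).2.2.1, ?_, ?_⟩
  · intro z hz
    have := D.B.a_mem z hz
    exact ⟨this.1, by linarith [this.2]⟩
  · intro z hz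
    have := D.B.b_mem z hz
    exact ⟨by linarith [this.1], this.2⟩
  · intro z hz z' hz' hS
    have h1 := q_diff1 D hz hz' hS
    have h2 := q_diff1 D hz' hz (SA_symm hS)
    rw [min_comm, rho_symm] at h2
    rw [abs_le]; constructor <;> linarith
  · rintro z hz z' hz' ⟨ℓ, h1, h2⟩
    exact ⟨ℓ+1, a_atom D.B D.hx1 D.hxpre ℓ z hz h1, a_atom D.B D.hx1 D.hxpre ℓ z' hz' h2⟩
  · intro z hz z' hz' hS
    have e : rhof (a z) (a z') = |Real.log (a z) - Real.log (a z')| := by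
      unfold rhof Gf
      rw [if_pos (D.B.a_mem z hz).2.le, if_pos (D.B.a_mem z' hz').2.le]
    rw [e]
    rcases le_total z' z with hl | hl
    · rw [min_eq_right hl]; exact rho_a1 D hz hz' hS hl
    · rw [min_eq_left hl, abs_sub_comm, rho_symm]; exact rho_a1 D hz' hz (SA_symm hS) hl
  · intro z hz z' hz' hS
    have hb := D.B.b_mem z hz
    have hb' := D.B.b_mem z' hz'
    have e : rhof (b z) (b z') = 2 * |b z - b z'| := by
      unfold rhof Gf; rw [if_neg (by linarith [hb.1]), if_neg (by linarith [hb'.1]), ← mul_sub, abs_mul]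
      norm_num
    rw [e]
    have hl := D.B.b_lip z hz z' hz'
    obtain ⟨h0, h0', -, -, h3⟩ := SA_cases D hS
    rcases h3 with ⟨h3, h4⟩ | ⟨h3, h4, h5, h6⟩
    · have k1 := abs_sub_le_log h0 h0'
      have k2 := (rho_facts D hS).1
      have k3 : max z z' ≤ 1/2 := max_le h3 h4
      have k4 : 0 ≤ |Real.log z - Real.log z'| := abs_nonneg _
      nlinarith
    · have e : rhof z z' = 2 * |z - z'| := by
        unfold rhof Gf; rw [if_neg (by linarith), if_neg (by linarith), ← mul_sub, abs_mul]
        norm_num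
      rw [e]; linarith

lemma drift_exists (D : Dat α T T' a b h p Mx c₁ c₂ C₁ xpt) (s : ℕ) (hs : s ≤ 2) :
    ∃ (f : ℝ → ℝ) (cf Cf : ℝ), 0 < cf ∧ 0 < Cf ∧
      (∀ z ∈ Ioo (0:ℝ) 1, cf / (z ^ α) ^ (2 * (s + 1)) ≤ f z) ∧
      (∀ z ∈ Ioo (0:ℝ) 1, f z ≤ Cf / (z ^ α) ^ (2 * (s + 1))) ∧
      (∀ z ∈ Ioo (0:ℝ) 1, p z * f (a z) + (1 - p z) * f (b z)
        ≤ f z - cf / (z ^ α) ^ (2 * s + 1) + Cf) := by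
  have hc1 := D.hc₁
  have hc2 := D.hc₂
  have hα0 := D.hα0
  have hα1 : α ≤ 1 := by linarith [D.hα7, D.hα0]
  have hdl : ∀ z ∈ Ioo (0:ℝ) 1, 1 / c₂ / (z ^ α) ^ (2 * (s + 1)) ≤ 1 / ((z ^ α) ^ (2 * s + 3) * h z) := by
    intro z hz
    have hzI : z ∈ Ioc (0:ℝ) 1 := ⟨hz.1, hz.2.le⟩
    have h1 := (hz_facts D hzI).2
    have hh := h_pos D hzI
    have hZ : 0 < z ^ α := Real.rpow_pos_of_pos hz.1 _
    rw [div_div, div_le_div_iff₀ (by positivity) (by positivity)]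
    have : (z ^ α) ^ (2 * s + 3) = z ^ α * (z ^ α) ^ (2 * (s + 1)) := by ring
    rw [this]
    calc 1 * (z ^ α * (z ^ α) ^ (2 * (s + 1)) * h z) = (h z * z ^ α) * (z ^ α) ^ (2 * (s + 1)) := by ring
      _ ≤ c₂ * (z ^ α) ^ (2 * (s + 1)) := by gcongr
      _ = _ := by ring
  refine ⟨fun z => 1 / ((z ^ α) ^ (2 * s + 3) * h z), α / (3 * c₂), 2 ^ (2 * s + 3) / c₁,
    by positivity, by positivity, ?_, ?_, ?_⟩
  · intro z hz
    have hZ : 0 < z ^ α := Real.rpow_pos_of_pos hz.1 _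
    refine le_trans ?_ (hdl z hz)
    gcongr
    linarith
  · intro z hz
    have hzI : z ∈ Ioc (0:ℝ) 1 := ⟨hz.1, hz.2.le⟩
    have h1 := (hz_facts D hzI).1
    have hh := h_pos D hzI
    have hZ : 0 < z ^ α := Real.rpow_pos_of_pos hz.1 _
    have h2 : (1:ℝ) ≤ 2 ^ (2 * s + 3) := one_le_pow₀ (by norm_num)
    have : 1 / ((z ^ α) ^ (2 * s + 3) * h z) ≤ 1 / c₁ / (z ^ α) ^ (2 * (s + 1)) := by
      rw [div_div, div_le_div_iff₀ (by positivity) (by positivity)]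
      have : (z ^ α) ^ (2 * s + 3) = z ^ α * (z ^ α) ^ (2 * (s + 1)) := by ring
      rw [this]
      calc 1 * (c₁ * (z ^ α) ^ (2 * (s + 1))) ≤ 1 * ((h z * z ^ α) * (z ^ α) ^ (2 * (s + 1))) := by
            gcongr
        _ = _ := by ring
    refine this.trans ?_
    gcongr
  · intro z hz
    have hzI : z ∈ Ioc (0:ℝ) 1 := ⟨hz.1, hz.2.le⟩
    have hh := h_pos D hzI
    have hZ : 0 < z ^ α := Real.rpow_pos_of_pos hz.1 _
    have ha := D.B.a_mem z hz
    have haI : a z ∈ Ioc (0:ℝ) 1 := ⟨ha.1, by linarith [ha.2]⟩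
    have hha := h_pos D haI
    have hA : 0 < a z ^ α := Real.rpow_pos_of_pos ha.1 _
    obtain ⟨u0, u1, u2, -⟩ := u_facts D hz
    have ez := D.B.za z hz
    have eT := D.B.T'a z hz
    obtain ⟨u, hu⟩ : ∃ u, u = (2 * a z) ^ α := ⟨_, rfl⟩
    rw [← hu] at u0 u1 u2 ez eT
    have q1 : 1 - p z ≤ 1 := by
      have := p_lower D hz
      have : 0 < c₁ / (3 * c₂) := by positivity
      linarith
    have q0 : 0 ≤ 1 - p z := by
      have := (q_bounds D hz).1
      have := D.B.hMx
      exact le_trans (by positivity) (q_bounds D hz).1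
    have part2 : (1 - p z) * (1 / ((b z ^ α) ^ (2 * s + 3) * h (b z))) ≤ 2 ^ (2 * s + 3) / c₁ := by
      obtain ⟨b1, -, b3, -⟩ := hb_facts D hz
      have hB : 0 < b z ^ α := by linarith
      have hhb : 0 < h (b z) := by linarith
      have : 1 / ((b z ^ α) ^ (2 * s + 3) * h (b z)) ≤ 2 ^ (2 * s + 3) / c₁ := by
        rw [div_le_div_iff₀ (by positivity) (by positivity)]
        calc 1 * c₁ ≤ (2 * b z ^ α) ^ (2 * s + 3) * h (b z) := by
              gcongr; exact one_le_pow₀ b3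
          _ = _ := by rw [mul_pow]; ring
      calc _ ≤ 1 * (1 / ((b z ^ α) ^ (2 * s + 3) * h (b z))) := by gcongr
        _ ≤ _ := by rw [one_mul]; exact this
    have part1 : p z * (1 / ((a z ^ α) ^ (2 * s + 3) * h (a z)))
        ≤ (1 - α / 3 * u) * (1 / ((z ^ α) ^ (2 * s + 3) * h z)) := by
      have eZ : (z ^ α) ^ (2 * s + 3) = (a z ^ α) ^ (2 * s + 3) * (1 + u) ^ (α * ((2 * s + 3 : ℕ) : ℝ)) := by
        nth_rewrite 1 [ez]
        rw [Real.mul_rpow ha.1.le (by positivity), mul_pow, ← Real.rpow_natCast ((1 + u) ^ α),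
          ← Real.rpow_mul (by positivity)]
      have hβ : α * ((2 * s + 3 : ℕ) : ℝ) ≤ 1 := by
        have : ((2 * s + 3 : ℕ) : ℝ) ≤ 7 := by exact_mod_cast (by omega : 2 * s + 3 ≤ 7)
        nlinarith [D.hα7]
      have hb1 : (1 + u) ^ (α * ((2 * s + 3 : ℕ) : ℝ)) ≤ 1 + u := by
        calc _ ≤ (1 + u) ^ (1:ℝ) := Real.rpow_le_rpow_of_exponent_le (by linarith) hβ
          _ = _ := Real.rpow_one _
      have hTp : 0 < T' (a z) := by rw [eT]; positivity
      have hb2 : (1 + u) ≤ (1 - α / 3 * u) * T' (a z) := by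
        rw [eT]
        have : 0 ≤ α * u := by positivity
        nlinarith [mul_nonneg this (by nlinarith : 0 ≤ 3 - (1 + (1 + α) * u))]
      rw [eZ, D.hp, div_mul_div_comm, mul_one_div, div_le_div_iff₀ (by positivity) (by positivity)]
      calc h (a z) * 1 * ((a z ^ α) ^ (2 * s + 3) * (1 + u) ^ (α * ((2 * s + 3 : ℕ) : ℝ)) * h z)
          = (h (a z) * (a z ^ α) ^ (2 * s + 3) * h z) * (1 + u) ^ (α * ((2 * s + 3 : ℕ) : ℝ)) := by ring
        _ ≤ (h (a z) * (a z ^ α) ^ (2 * s + 3) * h z) * ((1 - α / 3 * u) * T' (a z)) := by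
            gcongr; exact hb1.trans hb2
        _ = _ := by ring
    have part3 : α / (3 * c₂) / (z ^ α) ^ (2 * s + 1) ≤ α / 3 * u * (1 / ((z ^ α) ^ (2 * s + 3) * h z)) := by
      calc α / (3 * c₂) / (z ^ α) ^ (2 * s + 1)
          = α / 3 * z ^ α * (1 / c₂ / (z ^ α) ^ (2 * (s + 1))) := by
            have : (z ^ α) ^ (2 * (s + 1)) = z ^ α * (z ^ α) ^ (2 * s + 1) := by ring
            rw [this]; field_simp
        _ ≤ _ := by
            apply mul_le_mul _ (hdl z hz) (by positivity) (by positivity)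
            gcongr
    show p z * (1 / ((a z ^ α) ^ (2 * s + 3) * h (a z))) + (1 - p z) * (1 / ((b z ^ α) ^ (2 * s + 3) * h (b z))) ≤ _
    linarith
end

lemma K_lip {n : ℕ} {K : (Fin n → ℝ) → ℝ} {L : Fin n → ℝ}
    (hK : ∀ (j : Fin n) (z zz : Fin n → ℝ), (∀ i, i ≠ j → z i = zz i) →
        |K z - K zz| ≤ L j * |z j - zz j|) (z z' : Fin n → ℝ) :
    |K z - K z'| ≤ ∑ i, L i * |z i - z' i| := by
  classical
  have key : ∀ s : Finset (Fin n), |K z - K (fun i => if i ∈ s then z' i else z i)|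
      ≤ ∑ i ∈ s, L i * |z i - z' i| := by
    intro s
    induction s using Finset.induction_on with
    | empty => simp
    | insert j s hj ih =>
      rw [Finset.sum_insert hj]
      have h1 := hK j (fun i => if i ∈ s then z' i else z i)
        (fun i => if i ∈ insert j s then z' i else z i) (by
          intro i hi
          simp [Finset.mem_insert, hi])
      simp only [hj, Finset.mem_insert, true_or, if_true, if_false] at h1
      have h2 := abs_sub_le (K z) (K (fun i => if i ∈ s then z' i else z i))
        (K (fun i => if i ∈ insert j s then z' i else z i))
      simp only [Finset.mem_insert] at h2 ⊢
      linarith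
  have := key Finset.univ
  simpa using this

noncomputable def FS (a b : ℝ → ℝ) : ℕ → ℝ → Finset ℝ
  | 0 => fun x => {x}
  | (k+1) => fun x => FS a b k (a x) ∪ FS a b k (b x)

noncomputable def WW (T T' h : ℝ → ℝ) (k : ℕ) (x y : ℝ) : ℝ :=
  h y / (h x * |∏ j ∈ Finset.range k, T' (T^[j] y)|)

noncomputable def SS (T T' h a b : ℝ → ℝ) (k : ℕ) (G : ℝ → ℝ) (x : ℝ) : ℝ :=
  ∑ y ∈ FS a b k x, WW T T' h k x y * G y

section
variable {α : ℝ} {T T' a b h p : ℝ → ℝ} {Mx c₁ c₂ C₁ : ℝ} {xpt : ℕ → ℝ}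

lemma mem_FS (D : Dat α T T' a b h p Mx c₁ c₂ C₁ xpt)
    (hT_maps : MapsTo T (Icc (0:ℝ) 1) (Icc (0:ℝ) 1)) (k : ℕ) :
    ∀ x ∈ Ioo (0:ℝ) 1, ∀ y, y ∈ FS a b k x ↔ (y ∈ Ioc (0:ℝ) 1 ∧ T^[k] y = x) := by
  induction k with
  | zero =>
    intro x hx y
    simp only [FS, Finset.mem_singleton, Function.iterate_zero, id]
    constructor
    · rintro rfl; exact ⟨⟨hx.1, hx.2.le⟩, rfl⟩
    · exact fun h => h.2
  | succ k ih =>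
    intro x hx y
    have ha := D.B.a_mem x hx
    have hb := D.B.b_mem x hx
    simp only [FS, Finset.mem_union]
    rw [ih (a x) ⟨ha.1, by linarith [ha.2]⟩, ih (b x) ⟨by linarith [hb.1], hb.2⟩,
      Function.iterate_succ_apply']
    constructor
    · rintro (⟨h1, h2⟩ | ⟨h1, h2⟩)
      · exact ⟨h1, by rw [h2, D.B.Ta x hx]⟩
      · exact ⟨h1, by rw [h2, D.B.Tb x hx]⟩
    · rintro ⟨h1, h2⟩
      rcases D.B.pre x hx (T^[k] y) (hT_maps.iterate k ⟨h1.1.le, h1.2⟩) h2 with h3 | h3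
      · exact Or.inl ⟨h1, h3⟩
      · exact Or.inr ⟨h1, h3⟩

lemma SS_succ (D : Dat α T T' a b h p Mx c₁ c₂ C₁ xpt)
    (hT_maps : MapsTo T (Icc (0:ℝ) 1) (Icc (0:ℝ) 1)) (k : ℕ) (G : ℝ → ℝ) {x : ℝ}
    (hx : x ∈ Ioo (0:ℝ) 1) :
    SS T T' h a b (k+1) G x = p x * SS T T' h a b k G (a x) + (1 - p x) * SS T T' h a b k G (b x) := by
  have ha := D.B.a_mem x hx
  have hb := D.B.b_mem x hx
  have haI : a x ∈ Ioo (0:ℝ) 1 := ⟨ha.1, by linarith [ha.2]⟩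
  have hbI : b x ∈ Ioo (0:ℝ) 1 := ⟨by linarith [hb.1], hb.2⟩
  have pa := h_pos D ⟨haI.1, haI.2.le⟩
  have pb := h_pos D ⟨hbI.1, hbI.2.le⟩
  have px := h_pos D ⟨hx.1, hx.2.le⟩
  have hTa : 0 < T' (a x) := by
    rw [D.B.T'a x hx]
    have := (u_facts D hx).1
    have := D.hα0
    positivity
  have hTb : 0 < |T' (b x)| := by linarith [D.B.T'b1 x hx]
  have hdis : Disjoint (FS a b k (a x)) (FS a b k (b x)) := by
    rw [Finset.disjoint_left]
    intro y h1 h2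
    rw [mem_FS D hT_maps k _ haI] at h1
    rw [mem_FS D hT_maps k _ hbI] at h2
    linarith [h1.2.symm.trans h2.2, ha.2, hb.1]
  unfold SS
  simp only [FS]
  rw [Finset.sum_union hdis, Finset.mul_sum, Finset.mul_sum]
  congr 1
  · apply Finset.sum_congr rfl
    intro y hy
    rw [mem_FS D hT_maps k _ haI] at hy
    rw [← mul_assoc]
    congr 1
    rw [D.hp]
    unfold WW
    rw [Finset.prod_range_succ, hy.2, abs_mul, abs_of_pos hTa, div_mul_div_comm]
    have e : h (a x) * h y / (h x * T' (a x) * (h (a x) * |∏ j ∈ Finset.range k, T' (T^[j] y)|))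
      = (h (a x) * h y) / (h (a x) * (h x * (|∏ j ∈ Finset.range k, T' (T^[j] y)| * T' (a x)))) := by
      congr 1; ring
    rw [e, mul_div_mul_left _ _ pa.ne']
  · apply Finset.sum_congr rfl
    intro y hy
    rw [mem_FS D hT_maps k _ hbI] at hy
    rw [← mul_assoc]
    congr 1
    rw [D.hq x hx]
    unfold WW
    rw [Finset.prod_range_succ, hy.2, abs_mul, div_mul_div_comm]
    have e : h (b x) * h y / (h x * |T' (b x)| * (h (b x) * |∏ j ∈ Finset.range k, T' (T^[j] y)|))
      = (h (b x) * h y) / (h (b x) * (h x * (|∏ j ∈ Finset.range k, T' (T^[j] y)| * |T' (b x)|))) := by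
      congr 1; ring
    rw [e, mul_div_mul_left _ _ pb.ne']

lemma couple_step {p p' A B A' B' vaa vbb vab vba : ℝ} (hp0 : 0 ≤ p) (hp1 : p ≤ 1)
    (hp0' : 0 ≤ p') (hp1' : p' ≤ 1)
    (haa : |A - A'| ≤ vaa) (hbb : |B - B'| ≤ vbb) (hab : |A - B'| ≤ vab) (hba : |B - A'| ≤ vba) :
    |(p * A + (1 - p) * B) - (p' * A' + (1 - p') * B')| ≤
      min p p' * vaa + min (1 - p) (1 - p') * vbb + max (p - p') 0 * vab + max (p' - p) 0 * vba := by
  rw [abs_le] at *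
  rcases le_total p p' with h | h
  · rw [min_eq_left h, min_eq_right (by linarith), max_eq_right (by linarith),
      max_eq_left (by linarith)]
    have e : (p * A + (1 - p) * B) - (p' * A' + (1 - p') * B')
      = p * (A - A') + (1 - p') * (B - B') + (p' - p) * (B - A') := by ring
    rw [e]
    have q : 0 ≤ 1 - p' := by linarith
    have r : 0 ≤ p' - p := by linarith
    constructor
    · nlinarith [mul_le_mul_of_nonneg_left haa.1 hp0, mul_le_mul_of_nonneg_left hbb.1 q,
        mul_le_mul_of_nonneg_left hba.1 r]
    · nlinarith [mul_le_mul_of_nonneg_left haa.2 hp0, mul_le_mul_of_nonneg_left hbb.2 q,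
        mul_le_mul_of_nonneg_left hba.2 r]
  · rw [min_eq_right h, min_eq_left (by linarith), max_eq_left (by linarith),
      max_eq_right (by linarith)]
    have e : (p * A + (1 - p) * B) - (p' * A' + (1 - p') * B')
      = p' * (A - A') + (1 - p) * (B - B') + (p - p') * (A - B') := by ring
    rw [e]
    have q : 0 ≤ 1 - p := by linarith
    have r : 0 ≤ p - p' := by linarith
    constructor
    · nlinarith [mul_le_mul_of_nonneg_left haa.1 hp0', mul_le_mul_of_nonneg_left hbb.1 q,
        mul_le_mul_of_nonneg_left hab.1 r]
    · nlinarith [mul_le_mul_of_nonneg_left haa.2 hp0', mul_le_mul_of_nonneg_left hbb.2 q,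
        mul_le_mul_of_nonneg_left hab.2 r]

lemma SS_bound (D : Dat α T T' a b h p Mx c₁ c₂ C₁ xpt)
    (hT_maps : MapsTo T (Icc (0:ℝ) 1) (Icc (0:ℝ) 1)) (L : ℕ → ℝ) (G G' : ℝ → ℝ) (k : ℕ) :
    ∀ x ∈ Ioo (0:ℝ) 1, ∀ x' ∈ Ioo (0:ℝ) 1, ∀ c : ℝ,
      (∀ y y', T^[k] y = x → T^[k] y' = x' →
        |G y - G' y'| ≤ c + ∑ i ∈ Finset.range k, L i * |T^[i] y - T^[i] y'|) →
      |SS T T' h a b k G x - SS T T' h a b k G' x'| ≤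
        c + ∑ i ∈ Finset.range k, L i * UU a b p (k - i) x x' := by
  induction k with
  | zero =>
    intro x hx x' hx' c hG
    have px := h_pos D ⟨hx.1, hx.2.le⟩
    have px' := h_pos D ⟨hx'.1, hx'.2.le⟩
    have := hG x x' rfl rfl
    simpa [SS, FS, WW, px.ne', px'.ne'] using this
  | succ k ih =>
    intro x hx x' hx' c hG
    have S := cpl_exists D
    have hp0 := fun z hz => S.hp0.le.trans (S.p_ge z hz)
    have hp1 : ∀ z ∈ Ioo (0:ℝ) 1, p z ≤ 1 := fun z hz => by
      have := S.q_ge z hz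
      have := mul_nonneg S.hc3.le (Real.rpow_nonneg hz.1.le α)
      linarith
    have hgen : ∀ ξ ∈ Ioo (0:ℝ) 1, ∀ ξ' ∈ Ioo (0:ℝ) 1, T ξ = x → T ξ' = x' →
        |SS T T' h a b k G ξ - SS T T' h a b k G' ξ'| ≤
          c + ∑ i ∈ Finset.range (k+1), L i * UU a b p (k - i) ξ ξ' := by
      intro ξ hξ ξ' hξ' e e'
      have := ih ξ hξ ξ' hξ' (c + L k * |ξ - ξ'|) (by
        intro y y' h1 h2
        have h3 := hG y y' (by rw [Function.iterate_succ_apply', h1, e])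
          (by rw [Function.iterate_succ_apply', h2, e'])
        rw [Finset.sum_range_succ, h1, h2] at h3
        linarith)
      rw [Finset.sum_range_succ, Nat.sub_self]
      simp only [UU]
      linarith
    have ha := S.a_mem x hx
    have hb := S.b_mem x hx
    have ha' := S.a_mem x' hx'
    have hb' := S.b_mem x' hx'
    have ea := D.B.Ta x hx
    have eb := D.B.Tb x hx
    have ea' := D.B.Ta x' hx'
    have eb' := D.B.Tb x' hx'
    have main := couple_step (hp0 x hx) (hp1 x hx) (hp0 x' hx') (hp1 x' hx')
      (hgen _ ha _ ha' ea ea') (hgen _ hb _ hb' eb eb') (hgen _ ha _ hb' ea eb')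
      (hgen _ hb _ ha' eb ea')
    rw [SS_succ D hT_maps k G hx, SS_succ D hT_maps k G' hx']
    refine main.trans (le_of_eq ?_)
    have hs := QQ_sum a b p (fun i => UU a b p (k - i)) L (k+1) x x'
    have hw := QQ_w_sum (p x) (p x')
    have e2 : ∑ i ∈ Finset.range (k+1), L i * UU a b p (k + 1 - i) x x'
        = ∑ j ∈ Finset.range (k+1), L j * QQ a b p (UU a b p (k - j)) x x' := by
      apply Finset.sum_congr rfl
      intro i hi
      have : k + 1 - i = (k - i) + 1 := by
        have := Finset.mem_range.1 hi; omega
      rw [this]; rfl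
    rw [e2, ← hs]
    unfold QQ
    linear_combination c * hw

lemma Gamma_bound (D : Dat α T T' a b h p Mx c₁ c₂ C₁ xpt)
    (hT_maps : MapsTo T (Icc (0:ℝ) 1) (Icc (0:ℝ) 1)) {n : ℕ} {K : (Fin n → ℝ) → ℝ} {L : Fin n → ℝ}
    (hK : ∀ (j : Fin n) (z zz : Fin n → ℝ), (∀ i, i ≠ j → z i = zz i) →
        |K z - K zz| ≤ L j * |z j - zz j|) {k : ℕ} (hk : k ≤ n) (Lx : ℕ → ℝ)
    (hLx : ∀ i : Fin n, Lx i = L i) {x x' : ℝ}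
    (hx : x ∈ Ioo (0:ℝ) 1) (hx' : x' ∈ Ioo (0:ℝ) 1) (hT : T x = T x') :
    |GammaFun T T' h n k K x x'| ≤ ∑ i ∈ Finset.range k, Lx i * UU a b p (k - i) x x' := by
  have hPsi : ∀ x ∈ Ioo (0:ℝ) 1, PsiFun T T' h n k K x = SS T T' h a b k
      (fun y => K (fun i => if (i:ℕ) < k then T^[(i:ℕ)] (y:ℝ)
                  else if (i:ℕ) = k then 0 else T^[(i:ℕ) - k] x)) x := by
    intro x hx
    have hset : {y : ℝ | y ∈ Set.Ioc (0:ℝ) 1 ∧ T^[k] y = x} = ↑(FS a b k x) := by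
      ext y
      simp only [mem_setOf_eq, Finset.mem_coe]
      exact (mem_FS D hT_maps k x hx y).symm
    have := Finset.tsum_subtype' (FS a b k x) (fun y => WW T T' h k x y *
      K (fun i => if (i:ℕ) < k then T^[(i:ℕ)] (y:ℝ)
                  else if (i:ℕ) = k then 0 else T^[(i:ℕ) - k] x))
    rw [← hset] at this
    exact this
  unfold GammaFun
  rw [hPsi x hx, hPsi x' hx']
  have main := SS_bound D hT_maps Lx
    (fun y => K (fun i => if (i:ℕ) < k then T^[(i:ℕ)] (y:ℝ)
                  else if (i:ℕ) = k then 0 else T^[(i:ℕ) - k] x))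
    (fun y => K (fun i => if (i:ℕ) < k then T^[(i:ℕ)] (y:ℝ)
                  else if (i:ℕ) = k then 0 else T^[(i:ℕ) - k] x')) k x hx x' hx' 0 (by
    intro y y' _ _
    rw [zero_add]
    refine (K_lip hK _ _).trans (le_of_eq ?_)
    have e1 : ∀ i : Fin n, L i * |(if (i:ℕ) < k then T^[(i:ℕ)] (y:ℝ)
                  else if (i:ℕ) = k then 0 else T^[(i:ℕ) - k] x) -
                  (if (i:ℕ) < k then T^[(i:ℕ)] (y':ℝ)
                  else if (i:ℕ) = k then 0 else T^[(i:ℕ) - k] x')|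
        = (fun i : ℕ => if i < k then Lx i * |T^[i] y - T^[i] y'| else 0) i := by
      intro i
      simp only
      by_cases h1 : (i:ℕ) < k
      · simp only [h1, if_true, hLx]
      · by_cases h2 : (i:ℕ) = k
        · simp [h2]
        · obtain ⟨m, hm⟩ : ∃ m, (i:ℕ) - k = m + 1 := ⟨(i:ℕ) - k - 1, by omega⟩
          rw [if_neg h1, if_neg h1, if_neg h2, if_neg h2, if_neg h1, hm,
            Function.iterate_succ_apply, Function.iterate_succ_apply, hT]
          simp
    rw [Finset.sum_congr rfl (fun i _ => e1 i)]
    rw [Fin.sum_univ_eq_sum_range (fun i : ℕ => if i < k then Lx i * |T^[i] y - T^[i] y'| else 0) n]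
    rw [← Finset.sum_filter]
    apply Finset.sum_congr _ (fun _ _ => rfl)
    ext i
    simp only [Finset.mem_filter, Finset.mem_range]
    omega)
  rwa [zero_add] at main
end

lemma inner_sum_le (i N : ℕ) :
    ∑ k ∈ Finset.range N, (if i < k then 1 / ((((k - i : ℕ):ℝ) + 1) * (((k - i : ℕ):ℝ) + 2) / 2) else 0)
      ≤ 2 - 2 / (((N - i : ℕ):ℝ) + 1) := by
  induction N with
  | zero => simp
  | succ N ih =>
    rw [Finset.sum_range_succ]
    by_cases hi : i < N
    · rw [if_pos hi]
      have e : N + 1 - i = (N - i) + 1 := by omega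
      rw [e]
      push_cast
      obtain ⟨j, hj⟩ : ∃ j : ℝ, j = ((N - i : ℕ):ℝ) := ⟨_, rfl⟩
      have hj0 : 0 ≤ j := by rw [hj]; positivity
      rw [← hj] at ih ⊢
      have : 1 / ((j + 1) * (j + 2) / 2) = 2 / (j + 1) - 2 / (j + 1 + 1) := by
        field_simp; ring
      linarith
    · rw [if_neg hi]
      have : (2:ℝ) / (((N + 1 - i : ℕ):ℝ) + 1) ≤ 2 / (((N - i : ℕ):ℝ) + 1) := by
        gcongr
        omega
      linarith

lemma A_sum (g : ℕ → ℝ) (hg : ∀ i, 0 ≤ g i) (n : ℕ) :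
    ∑ k ∈ Finset.Icc 1 n, ∑ i ∈ Finset.range k,
      g i / ((((k - i : ℕ):ℝ) + 1) * (((k - i : ℕ):ℝ) + 2) / 2) ≤ 2 * ∑ i ∈ Finset.range n, g i := by
  have h1 : ∀ k ∈ Finset.Icc 1 n, ∑ i ∈ Finset.range k,
      g i / ((((k - i : ℕ):ℝ) + 1) * (((k - i : ℕ):ℝ) + 2) / 2)
      = ∑ i ∈ Finset.range n, g i * (if i < k then
        1 / ((((k - i : ℕ):ℝ) + 1) * (((k - i : ℕ):ℝ) + 2) / 2) else 0) := by
    intro k hk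
    simp only [mul_ite, mul_zero, mul_one_div]
    rw [← Finset.sum_filter]
    apply Finset.sum_congr _ (fun _ _ => rfl)
    ext i
    have := Finset.mem_Icc.1 hk
    simp only [Finset.mem_filter, Finset.mem_range]
    omega
  rw [Finset.sum_congr rfl h1, Finset.sum_comm, Finset.mul_sum]
  apply Finset.sum_le_sum
  intro i _
  rw [← Finset.mul_sum, mul_comm 2]
  apply mul_le_mul_of_nonneg_left _ (hg i)
  have h2 := inner_sum_le i (n+1)
  have h3 : (0:ℝ) ≤ 2 / (((n + 1 - i : ℕ):ℝ) + 1) := by positivity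
  refine le_trans ?_ (h2.trans (by linarith))
  apply Finset.sum_le_sum_of_subset_of_nonneg
  · intro k hk
    have := Finset.mem_Icc.1 hk
    exact Finset.mem_range.2 (by omega)
  · intro k _ _
    split_ifs <;> positivity

section
variable {α : ℝ} {T T' a b h p : ℝ → ℝ} {Mx c₁ c₂ C₁ : ℝ} {xpt : ℕ → ℝ}

lemma cs_bound {U : ℕ → ℝ} (hU : ∀ j, 0 ≤ U j ∧ U j ≤ 1) {R : ℝ}
    (hR : ∀ N, ∑ j ∈ Finset.range N, (((j:ℝ) + 1) * (j + 2) / 2) * U j ≤ R) (Lx : ℕ → ℝ) (k : ℕ) :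
    (∑ i ∈ Finset.range k, Lx i * U (k - i)) ^ 2 ≤
      (∑ i ∈ Finset.range k, Lx i ^ 2 / ((((k - i : ℕ):ℝ) + 1) * (((k - i : ℕ):ℝ) + 2) / 2)) * R := by
  have h1 := Finset.sum_sq_le_sum_mul_sum_of_sq_eq_mul (Finset.range k)
    (r := fun i => Lx i * U (k - i))
    (f := fun i => Lx i ^ 2 / ((((k - i : ℕ):ℝ) + 1) * (((k - i : ℕ):ℝ) + 2) / 2))
    (g := fun i => ((((k - i : ℕ):ℝ) + 1) * (((k - i : ℕ):ℝ) + 2) / 2) * U (k - i) ^ 2)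
    (fun i _ => by positivity) (fun i _ => by positivity)
    (fun i _ => by
      have : ((((k - i : ℕ):ℝ) + 1) * (((k - i : ℕ):ℝ) + 2) / 2) ≠ 0 := by positivity
      field_simp)
  refine h1.trans ?_
  apply mul_le_mul_of_nonneg_left _ (Finset.sum_nonneg fun i _ => by positivity)
  refine le_trans ?_ (hR (k+1))
  have e := Finset.sum_range_reflect (fun j : ℕ => (((j:ℝ) + 1) * (j + 2) / 2) * U j) (k+1)
  rw [← e, Finset.sum_range_succ]
  simp only [Nat.add_sub_cancel, Nat.sub_self]
  have : ∀ j, U j ^ 2 ≤ U j := fun j => by nlinarith [(hU j).1, (hU j).2]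
  have h0 := (hU 0).1
  have h2 : ∑ i ∈ Finset.range k, ((((k - i : ℕ):ℝ) + 1) * (((k - i : ℕ):ℝ) + 2) / 2) * U (k - i) ^ 2
      ≤ ∑ i ∈ Finset.range k, ((((k - i : ℕ):ℝ) + 1) * (((k - i : ℕ):ℝ) + 2) / 2) * U (k - i) := by
    apply Finset.sum_le_sum
    intro i _
    apply mul_le_mul_of_nonneg_left (this _) (by positivity)
  have h3 : 0 ≤ (((0:ℕ):ℝ) + 1) * (((0:ℕ):ℝ) + 2) / 2 * U 0 := by positivity
  linarith

lemma pow_bound {α cx Cx x wt : ℝ} {ℓ : ℕ} (hα0 : 0 < α) (hα7 : 7 * α < 1) (hcx : 0 < cx)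
    (hCx : 0 < Cx)
    (hx : cx * ((ℓ + 2 : ℕ):ℝ) ^ (-(1/α)) ≤ x)
    (hw : wt ≤ Cx * ((ℓ + 1 : ℕ):ℝ) ^ (-(1/α) - 1)) :
    wt * (1 / (x ^ α) ^ 3) ≤ (8 * Cx / (cx ^ α) ^ 3) * (1 / (((ℓ:ℝ) + 1) ^ 2)) := by
  have hx0 : 0 < x := lt_of_lt_of_le (by positivity) hx
  have h1 : cx ^ α / ((ℓ:ℝ) + 2) ≤ x ^ α := by
    have := Real.rpow_le_rpow (by positivity) hx hα0.le
    rw [Real.mul_rpow hcx.le (by positivity), ← Real.rpow_mul (by positivity)] at this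
    have e : -(1/α) * α = -1 := by field_simp
    rw [e, Real.rpow_neg_one] at this
    push_cast at this
    rwa [div_eq_mul_inv]
  have hca : 0 < cx ^ α := Real.rpow_pos_of_pos hcx _
  have h2 : 1 / (x ^ α) ^ 3 ≤ (2 * ((ℓ:ℝ) + 1)) ^ 3 / (cx ^ α) ^ 3 := by
    calc 1 / (x ^ α) ^ 3 ≤ 1 / (cx ^ α / ((ℓ:ℝ) + 2)) ^ 3 := by gcongr
      _ = ((ℓ:ℝ) + 2) ^ 3 / (cx ^ α) ^ 3 := by rw [div_pow, one_div_div]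
      _ ≤ _ := by gcongr; linarith
  have h3 : wt ≤ Cx * (1 / ((ℓ:ℝ) + 1) ^ 5) := by
    refine hw.trans ?_
    gcongr
    push_cast
    have e : (1:ℝ) / ((ℓ:ℝ) + 1) ^ 5 = ((ℓ:ℝ) + 1) ^ (-(5:ℝ)) := by
      rw [Real.rpow_neg (by positivity), one_div]; norm_cast
    rw [e]
    apply Real.rpow_le_rpow_of_exponent_le
    · have : (0:ℝ) ≤ ℓ := by positivity
      linarith
    · have : 7 ≤ 1 / α := by rw [le_div_iff₀ hα0]; linarith
      linarith
  calc wt * (1 / (x ^ α) ^ 3) ≤ (Cx * (1 / ((ℓ:ℝ) + 1) ^ 5)) * ((2 * ((ℓ:ℝ) + 1)) ^ 3 / (cx ^ α) ^ 3) := by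
        gcongr
    _ = _ := by field_simp; ring

lemma final_bound (D : Dat α T T' a b h p Mx c₁ c₂ C₁ xpt)
    (hT_maps : MapsTo T (Icc (0:ℝ) 1) (Icc (0:ℝ) 1))
    (hT1 : ∀ x ∈ Ioc (0:ℝ) (1/2), T x ≠ T 1)
    {cx Cx : ℝ} (hcx : 0 < cx) (hcxCx : cx ≤ Cx)
    (hxasym : ∀ ℓ : ℕ, 1 ≤ ℓ →
      cx * (ℓ:ℝ) ^ (-(1/α)) ≤ xpt ℓ ∧ xpt ℓ ≤ Cx * (ℓ:ℝ) ^ (-(1/α)))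
    (hIasym : ∀ ℓ : ℕ, 1 ≤ ℓ →
      cx * (ℓ:ℝ) ^ (-(1/α) - 1) ≤ xpt ℓ - xpt (ℓ + 1) ∧
        xpt ℓ - xpt (ℓ + 1) ≤ Cx * (ℓ:ℝ) ^ (-(1/α) - 1)) :
    ∃ H > (0:ℝ), ∀ n : ℕ, 1 ≤ n → ∀ (K : (Fin n → ℝ) → ℝ) (L : Fin n → ℝ),
      (∀ (j : Fin n) (z zz : Fin n → ℝ), (∀ i, i ≠ j → z i = zz i) →
        |K z - K zz| ≤ L j * |z j - zz j|) →
      (∀ j, 0 < L j) →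
      ∑ k ∈ Finset.Icc 1 n,
        (∑' ℓ : ℕ, (xpt (ℓ + 1) - xpt (ℓ + 2)) *
          sSup {r : ℝ | ∃ x ∈ Ioc (xpt (ℓ + 2)) (xpt (ℓ + 1)),
            ∃ x' ∈ Ioc (xpt 1) (xpt 0), T x = T x' ∧
              r = (GammaFun T T' h n k K x x') ^ 2})
        ≤ H * ∑ j, (L j) ^ 2 := by
  have S := cpl_exists D
  obtain ⟨C, hC, hG⟩ := green_main S (fun s hs => drift_exists D s hs)
  have hCx : 0 < Cx := hcx.trans_le hcxCx
  have hca : 0 < cx ^ α := Real.rpow_pos_of_pos hcx _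
  have hα0 := D.hα0
  have hsum : Summable (fun ℓ : ℕ => 1 / (((ℓ:ℝ) + 1) ^ 2)) := by
    have := (summable_nat_add_iff 1).2 (Real.summable_one_div_nat_pow.2 (by norm_num : 1 < 2))
    simpa using this
  obtain ⟨Z, hZ⟩ : ∃ Z, Z = ∑' ℓ : ℕ, 1 / (((ℓ:ℝ) + 1) ^ 2) := ⟨_, rfl⟩
  have hZ0 : 0 ≤ Z := by rw [hZ]; exact tsum_nonneg (fun ℓ => by positivity)
  obtain ⟨E, hE⟩ : ∃ E, E = C * (8 * Cx / (cx ^ α) ^ 3) := ⟨_, rfl⟩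
  have hE0 : 0 < E := by rw [hE]; positivity
  refine ⟨2 * (E * Z) + 1, by positivity, ?_⟩
  intro n hn K L hK hL
  classical
  obtain ⟨Lx, hLxd⟩ : ∃ Lx : ℕ → ℝ, Lx = fun i => if hi : i < n then L ⟨i, hi⟩ else 0 := ⟨_, rfl⟩
  have hLx : ∀ i : Fin n, Lx i = L i := by
    intro i; rw [hLxd]; simp
  have hkbound : ∀ k ∈ Finset.Icc 1 n,
      (∑' ℓ : ℕ, (xpt (ℓ + 1) - xpt (ℓ + 2)) *
          sSup {r : ℝ | ∃ x ∈ Ioc (xpt (ℓ + 2)) (xpt (ℓ + 1)),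
            ∃ x' ∈ Ioc (xpt 1) (xpt 0), T x = T x' ∧
              r = (GammaFun T T' h n k K x x') ^ 2}) ≤
      (∑ i ∈ Finset.range k, Lx i ^ 2 / ((((k - i : ℕ):ℝ) + 1) * (((k - i : ℕ):ℝ) + 2) / 2)) * (E * Z) := by
    intro k hk
    have hkn := (Finset.mem_Icc.1 hk).2
    obtain ⟨A, hA⟩ : ∃ A, A = ∑ i ∈ Finset.range k, Lx i ^ 2 / ((((k - i : ℕ):ℝ) + 1) * (((k - i : ℕ):ℝ) + 2) / 2) := ⟨_, rfl⟩
    have hA0 : 0 ≤ A := by rw [hA]; exact Finset.sum_nonneg fun i _ => by positivity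
    rw [← hA]
    have hwpos : ∀ ℓ, 0 < xpt (ℓ + 1) - xpt (ℓ + 2) := fun ℓ => sub_pos.2 (D.hxdec (ℓ+1))
    have hterm : ∀ ℓ : ℕ, (xpt (ℓ + 1) - xpt (ℓ + 2)) *
          sSup {r : ℝ | ∃ x ∈ Ioc (xpt (ℓ + 2)) (xpt (ℓ + 1)),
            ∃ x' ∈ Ioc (xpt 1) (xpt 0), T x = T x' ∧
              r = (GammaFun T T' h n k K x x') ^ 2} ≤ A * E * (1 / (((ℓ:ℝ) + 1) ^ 2)) := by
      intro ℓ
      have hlow := (hxasym (ℓ+2) (by omega)).1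
      have hwt := (hIasym (ℓ+1) (by omega)).2
      have hpb := pow_bound hα0 D.hα7 hcx hCx hlow hwt
      have hxl := D.hxpos (ℓ+2)
      have hx12 : xpt (ℓ+1) ≤ 1/2 := by
        rw [← D.hx1]; exact antitone_nat_of_succ_le (fun n => (D.hxdec n).le) (by omega)
      have hs : sSup {r : ℝ | ∃ x ∈ Ioc (xpt (ℓ + 2)) (xpt (ℓ + 1)),
            ∃ x' ∈ Ioc (xpt 1) (xpt 0), T x = T x' ∧
              r = (GammaFun T T' h n k K x x') ^ 2} ≤ A * (C * (1 / (xpt (ℓ+2) ^ α) ^ 3)) := by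
        have hpp : 0 < xpt (ℓ+2) ^ α := Real.rpow_pos_of_pos hxl _
        apply Real.sSup_le _ (by positivity)
        rintro r ⟨x, hx, x', hx', hT, rfl⟩
        rw [D.hx1, D.hx0] at hx'
        have hxI : x ∈ Ioo (0:ℝ) 1 := ⟨hxl.trans hx.1, by linarith [hx.2]⟩
        have hx'1 : x' ≠ 1 := by
          rintro rfl
          exact hT1 x ⟨hxI.1, hx.2.trans hx12⟩ hT
        have hxI' : x' ∈ Ioo (0:ℝ) 1 := ⟨by linarith [hx'.1], lt_of_le_of_ne hx'.2 hx'1⟩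
        have hb := Gamma_bound D hT_maps hK hkn Lx hLx hxI hxI' hT
        have hcs := cs_bound (U := fun j => UU a b p j x x')
          (fun j => UU_mem S j x hxI x' hxI') (fun N => hG N x hxI x' hxI') Lx k
        rw [← hA] at hcs
        have hmin : min x x' = x := min_eq_left (by linarith [hx.2, hx'.1])
        rw [hmin] at hcs
        calc (GammaFun T T' h n k K x x') ^ 2 = |GammaFun T T' h n k K x x'| ^ 2 := (sq_abs _).symm
          _ ≤ (∑ i ∈ Finset.range k, Lx i * UU a b p (k - i) x x') ^ 2 := by gcongr
          _ ≤ A * (C / (x ^ α) ^ 3) := hcs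
          _ ≤ A * (C / (xpt (ℓ+2) ^ α) ^ 3) := by
              have := hx.1.le
              gcongr
          _ = _ := by rw [mul_one_div]
      calc _ ≤ (xpt (ℓ + 1) - xpt (ℓ + 2)) * (A * (C * (1 / (xpt (ℓ+2) ^ α) ^ 3))) :=
            mul_le_mul_of_nonneg_left hs (hwpos ℓ).le
        _ = A * C * ((xpt (ℓ + 1) - xpt (ℓ + 2)) * (1 / (xpt (ℓ+2) ^ α) ^ 3)) := by ring
        _ ≤ A * C * ((8 * Cx / (cx ^ α) ^ 3) * (1 / (((ℓ:ℝ) + 1) ^ 2))) := by gcongr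
        _ = _ := by rw [hE]; ring
    have hnn : ∀ ℓ : ℕ, 0 ≤ (xpt (ℓ + 1) - xpt (ℓ + 2)) *
          sSup {r : ℝ | ∃ x ∈ Ioc (xpt (ℓ + 2)) (xpt (ℓ + 1)),
            ∃ x' ∈ Ioc (xpt 1) (xpt 0), T x = T x' ∧
              r = (GammaFun T T' h n k K x x') ^ 2} := by
      intro ℓ
      apply mul_nonneg (hwpos ℓ).le
      apply Real.sSup_nonneg
      rintro r ⟨x, -, x', -, -, rfl⟩
      positivity
    have hs2 : Summable (fun ℓ : ℕ => A * E * (1 / (((ℓ:ℝ) + 1) ^ 2))) := hsum.mul_left _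
    have := Summable.tsum_le_tsum hterm (Summable.of_nonneg_of_le hnn hterm hs2) hs2
    rw [tsum_mul_left, ← hZ] at this
    linarith
  refine (Finset.sum_le_sum hkbound).trans ?_
  rw [← Finset.sum_mul]
  have h1 := A_sum (fun i => Lx i ^ 2) (fun i => by positivity) n
  have h2 : ∑ j, (L j) ^ 2 = ∑ i ∈ Finset.range n, Lx i ^ 2 := by
    rw [← Fin.sum_univ_eq_sum_range (fun i => Lx i ^ 2) n]
    exact Finset.sum_congr rfl (fun i _ => by rw [hLx])
  rw [h2]
  have h3 : 0 ≤ ∑ i ∈ Finset.range n, Lx i ^ 2 := Finset.sum_nonneg fun i _ => by positivity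
  have h4 : 0 ≤ E * Z := by positivity
  nlinarith [mul_le_mul_of_nonneg_right h1 h4]
end

/-- **Lemma `quasidevroye`**: for `α ∈ (0, 4-√15)` there is `H > 0` such that
for every `n ≥ 1` and every componentwise Lipschitz `K : [0,1]^n → ℝ` with
`inf_j Lip_j(K) > 0`, `∑_{k=1}^n Q_k ≤ H ∑_{j=1}^n Lip_j(K)²`, where
`Q_k = ∑_{ℓ≥1} |I_ℓ| sup{Γ_k(x,x')² : x ∈ I_ℓ, x' ∈ I₀, Tx = Tx'}`. -/
theorem quasidevroye_intermittent_map
    (α : ℝ) (hα0 : 0 < α) (hα1 : α < 4 - Real.sqrt 15)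
    (T : ℝ → ℝ) (hT_maps : MapsTo T (Icc (0:ℝ) 1) (Icc (0:ℝ) 1))
    (hT_formula : ∀ x ∈ Ico (0:ℝ) (1/2), T x = x + (2:ℝ) ^ α * x ^ (1 + α))
    (T' : ℝ → ℝ)
    (hT_deriv : ∀ x ∈ Icc (0:ℝ) 1, x ≠ 1/2 → HasDerivAt T (T' x) x)
    (hT_C2 : ContDiffOn ℝ 2 T (Icc (1/2:ℝ) 1))
    (hT_bij : BijOn T (Icc (1/2:ℝ) 1) (Icc (0:ℝ) 1))
    (hT_expanding : ∀ x ∈ Icc (1/2:ℝ) 1, 1 < |T' x|)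
    -- Markov partition points x_ℓ and atoms I_ℓ = (x_{ℓ+1}, x_ℓ]
    (xpt : ℕ → ℝ) (hx0 : xpt 0 = 1) (hx1 : xpt 1 = 1/2)
    (hxpos : ∀ ℓ, 0 < xpt ℓ) (hxdec : ∀ ℓ, xpt (ℓ + 1) < xpt ℓ)
    (hxpre : ∀ ℓ, 2 ≤ ℓ → xpt ℓ ∈ Ioo (0:ℝ) (1/2) ∧ T (xpt ℓ) = xpt (ℓ - 1))
    -- two-sided asymptotics of x_ℓ and |I_ℓ|
    (cx Cx : ℝ) (hcx : 0 < cx) (hcxCx : cx ≤ Cx)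
    (hxasym : ∀ ℓ : ℕ, 1 ≤ ℓ →
      cx * (ℓ:ℝ) ^ (-(1/α)) ≤ xpt ℓ ∧ xpt ℓ ≤ Cx * (ℓ:ℝ) ^ (-(1/α)))
    (hIasym : ∀ ℓ : ℕ, 1 ≤ ℓ →
      cx * (ℓ:ℝ) ^ (-(1/α) - 1) ≤ xpt ℓ - xpt (ℓ + 1) ∧
        xpt ℓ - xpt (ℓ + 1) ≤ Cx * (ℓ:ℝ) ^ (-(1/α) - 1))
    -- invariant density
    (h : ℝ → ℝ) (c₁ c₂ : ℝ) (hc₁ : 0 < c₁) (hc₁₂ : c₁ ≤ c₂)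
    (hdens : ∀ x ∈ Ioc (0:ℝ) 1, c₁ * x ^ (-α) ≤ h x ∧ h x ≤ c₂ * x ^ (-α))
    (μ : Measure ℝ) (hprob : IsProbabilityMeasure μ)
    (hμ : μ = (volume.restrict (Icc (0:ℝ) 1)).withDensity (fun x => ENNReal.ofReal (h x)))
    (hinv : MeasurePreserving T μ μ)
    -- correlation decay estimate
    (C₀ : ℝ) (hC₀ : 0 < C₀)
    (hdecay : ∀ (v w : ℝ → ℝ) (Mv : ℝ) (Lw : NNReal),
      ContinuousOn v (Icc (0:ℝ) 1) → (∀ x ∈ Icc (0:ℝ) 1, |v x| ≤ Mv) →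
      LipschitzOnWith Lw w (Icc (0:ℝ) 1) →
      ∀ ℓ : ℕ, 1 ≤ ℓ →
        |(∫ x, v (T^[ℓ] x) * w x ∂μ) - (∫ x, v x ∂μ) * (∫ x, w x ∂μ)|
          ≤ C₀ * Mv * (Lw : ℝ) * (ℓ : ℝ) ^ (1 - 1/α))
    -- distortion estimates
    (C₁ : ℝ) (hC₁ : 0 < C₁)
    (hdist1 : ∀ ℓ : ℕ, ∀ y ∈ Ioc (xpt (ℓ + 1)) (xpt ℓ), ∀ yt ∈ Ioc (xpt (ℓ + 1)) (xpt ℓ),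
      h yt / h y ≤ 1 + C₁ * |y - yt| / y)
    (hdist2 : ∀ m : ℕ, 1 ≤ m → ∀ z zt : ℝ,
      (∀ j ≤ m, ∃ ℓ : ℕ, T^[j] z ∈ Ioc (xpt (ℓ + 1)) (xpt ℓ) ∧
        T^[j] zt ∈ Ioc (xpt (ℓ + 1)) (xpt ℓ)) →
      |∏ j ∈ Finset.range m, T' (T^[j] zt)| / |∏ j ∈ Finset.range m, T' (T^[j] z)|
        ≤ 1 + C₁ * |T^[m] z - T^[m] zt| / T^[m] z) :
    ∃ H > (0:ℝ), ∀ n : ℕ, 1 ≤ n → ∀ (K : (Fin n → ℝ) → ℝ) (L : Fin n → ℝ),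
      (∀ (j : Fin n) (z zz : Fin n → ℝ), (∀ i, i ≠ j → z i = zz i) →
        |K z - K zz| ≤ L j * |z j - zz j|) →
      (∀ j, 0 < L j) →
      ∑ k ∈ Finset.Icc 1 n,
        (∑' ℓ : ℕ, (xpt (ℓ + 1) - xpt (ℓ + 2)) *
          sSup {r : ℝ | ∃ x ∈ Ioc (xpt (ℓ + 2)) (xpt (ℓ + 1)),
            ∃ x' ∈ Ioc (xpt 1) (xpt 0), T x = T x' ∧
              r = (GammaFun T T' h n k K x x') ^ 2})
        ≤ H * ∑ j, (L j) ^ 2 := by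
  have hα7 : 7 * α < 1 := by
    have : (27/7:ℝ) < Real.sqrt 15 := by
      apply Real.lt_sqrt_of_sq_lt; norm_num
    linarith
  obtain ⟨a, b, Mx, B⟩ := Brn_exists hα0 hT_formula hT_deriv hT_C2 hT_bij hT_expanding
  have hat := atom_exists hα0 hx0 hxasym
  have hpos : ∀ x ∈ Ioc (0:ℝ) 1, 0 < h x := fun x hx =>
    (mul_pos hc₁ (Real.rpow_pos_of_pos hx.1 _)).trans_le (hdens x hx).1
  have hid := inv_identity hα0 B hprob hμ hinv hT_deriv hT_C2 hT_bij hx0 hx1 hxpos hxdec hxpre hat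
    hpos hC₁ hdist1
  have hTL := left_formula hα0 hT_formula
  have D : Dat α T T' a b h (fun z => h (a z) / (h z * T' (a z))) Mx c₁ c₂ C₁ xpt := by
    refine ⟨B, hα0, hα7, hx0, hx1, hxpos, hxdec, hxpre, ?_, hc₁, hc₁.trans_le hc₁₂, hdens, hC₁,
      hdist1, ?_, fun _ => rfl, ?_⟩
    · intro ℓ
      rcases Nat.eq_zero_or_pos ℓ with h0 | h0
      · subst h0; rw [hx0, zero_add, hx1]; norm_num
      · obtain ⟨h1, h2⟩ := hxpre (ℓ+1) (by omega)
        rw [Nat.add_sub_cancel, hTL _ ⟨h1.1.le, h1.2⟩] at h2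
        have h3 : (2 * xpt (ℓ+1)) ^ α ≤ 1 :=
          Real.rpow_le_one (by linarith [h1.1]) (by linarith [h1.2]) hα0.le
        have h4 := h1.1
        nlinarith
    · intro z hz z' hz' hS
      have hb := B.b_mem z hz
      have hb' := B.b_mem z' hz'
      have := hdist2 1 le_rfl (b z) (b z') (by
        intro j hj
        rcases Nat.le_one_iff_eq_zero_or_eq_one.1 hj with h0 | h0
        · subst h0
          refine ⟨0, ?_, ?_⟩ <;> rw [hx0, zero_add, hx1]
          · exact ⟨hb.1, hb.2.le⟩
          · exact ⟨hb'.1, hb'.2.le⟩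
        · subst h0
          simpa [B.Tb z hz, B.Tb z' hz'] using hS)
      simpa [B.Tb z hz, B.Tb z' hz'] using this
    · intro z hz
      have hh := hpos z ⟨hz.1, hz.2.le⟩
      have e := hid z hz
      have e1 : h (a z) / (h z * T' (a z)) = (h (a z) / T' (a z)) / h z := by
        rw [div_div, mul_comm]
      have e2 : h (b z) / (h z * |T' (b z)|) = (h (b z) / |T' (b z)|) / h z := by
        rw [div_div, mul_comm]
      rw [e1, e2, eq_div_iff hh.ne', sub_mul, div_mul_cancel₀ _ hh.ne']
      linarith
  have hT1 : ∀ x ∈ Ioc (0:ℝ) (1/2), T x ≠ T 1 := by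
    intro x hx
    rcases lt_or_eq_of_le hx.2 with hl | hl
    · have hu : 0 < (2 * x) ^ α := Real.rpow_pos_of_pos (by linarith [hx.1]) _
      have hu1 : (2 * x) ^ α ≤ 1 :=
        Real.rpow_le_one (by linarith [hx.1]) (by linarith [hx.2]) hα0.le
      have h0 := hx.1
      rw [hTL x ⟨hx.1.le, hl⟩]
      rcases right_mono hT_C2 hT_bij with ⟨-, -, h1⟩ | ⟨-, -, h1⟩ <;> rw [h1]
      · apply ne_of_lt; nlinarith
      · apply ne_of_gt; positivity
    · rw [hl]
      rcases right_mono hT_C2 hT_bij with ⟨-, h2, h1⟩ | ⟨-, h2, h1⟩ <;> rw [h1, h2] <;> norm_num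
  exact final_bound D hT_maps hT1 hcx hcxCx hxasym hIasym
end

section
/- There exists a constant C > 0 such that for every integer m ≥ 1 and every pair of points z, z̃ ∈ (0,1] with the property that for every 0 ≤ j ≤ m the points T^j z and T^j z̃ belong to the same atom of the Markov partition, one has |z − z̃| ≤ ( C / (m+1)^{1/α} ) · |T^m z − T^m z̃| / T^m z. -/
open Set

/-- gain of the potential `x ^ (-α)` under one step of the left branch -/
lemma left_gain (α : ℝ) (hα0 : 0 < α) (hα1 : α < 1) (x : ℝ) (hx : 0 < x) (hx2 : x ≤ 1/2) :
    (x * (1 + (2:ℝ)^α * x^α)) ^ (-α) + α / 4 ≤ x ^ (-α) := by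
  set u := (2:ℝ)^α * x^α with hu
  have hu0 : 0 < u := by positivity
  have hu1 : u ≤ 1 := by
    rw [hu, ← Real.mul_rpow (by norm_num) hx.le]
    exact Real.rpow_le_one (by positivity) (by linarith) hα0.le
  have h2 : (1:ℝ) ≤ 2^α := Real.one_le_rpow (by norm_num) hα0.le
  have hlog : u / 2 ≤ Real.log (1 + u) := by
    have h := Real.one_sub_inv_le_log_of_pos (show 0 < 1 + u by linarith)
    have h' : u / 2 ≤ 1 - (1 + u)⁻¹ := by
      have : 1 - (1+u)⁻¹ = u / (1 + u) := by field_simp; ring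
      rw [this]
      exact div_le_div_of_nonneg_left hu0.le (by linarith) (by linarith)
    linarith
  have hv : 1 + α * u / 2 ≤ (1 + u)^α := by
    rw [Real.rpow_def_of_pos (by linarith)]
    have := Real.add_one_le_exp (Real.log (1+u) * α)
    nlinarith
  have hw : (1 + u)^(-α) ≤ 1 - α * u / 4 := by
    rw [Real.rpow_neg (by linarith)]
    have hp : 0 < 1 + α * u / 2 := by positivity
    refine (inv_anti₀ hp hv).trans ?_
    rw [inv_le_iff_one_le_mul₀ hp]
    have : α * u ≤ 1 := by nlinarith
    have h0 : 0 < α * u := by positivity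
    nlinarith
  rw [Real.mul_rpow hx.le (by linarith)]
  have hxa : x^(-α) * u = 2^α := by
    rw [hu, Real.rpow_neg hx.le]
    have : x^α ≠ 0 := by positivity
    field_simp
  have hxp : 0 < x^(-α) := by positivity
  have h3 := mul_le_mul_of_nonneg_left hw hxp.le
  have h4 : x^(-α) * (1 - α * u / 4) = x^(-α) - α / 4 * 2^α := by
    rw [← hxa]; ring
  rw [h4] at h3
  nlinarith

/-- slope bound for the left branch -/
lemma left_slope (α : ℝ) (hα0 : 0 < α) (a b c : ℝ) (ha : 0 < a) (hb : 0 < b) (hc : 0 < c) :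
    |a - b| * (1 + c * a^α) ≤ |(a * (1 + c * a^α)) - (b * (1 + c * b^α))| := by
  rcases le_total a b with h | h
  · have h1 : a^α ≤ b^α := Real.rpow_le_rpow ha.le h hα0.le
    have h2 : c * a^α ≤ c * b^α := by gcongr
    rw [abs_of_nonpos (by linarith), abs_sub_comm]
    refine le_trans ?_ (le_abs_self _)
    nlinarith [mul_le_mul_of_nonneg_left h2 hb.le]
  · have h1 : b^α ≤ a^α := Real.rpow_le_rpow hb.le h hα0.le
    have h2 : c * b^α ≤ c * a^α := by gcongr
    rw [abs_of_nonneg (by linarith)]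
    refine le_trans ?_ (le_abs_self _)
    nlinarith [mul_le_mul_of_nonneg_left h2 hb.le]

/-- one-step expansion on the right branch -/
lemma right_expand_s16 (T T' : ℝ → ℝ)
    (hT_deriv : ∀ x ∈ Icc (0:ℝ) 1, x ≠ 1/2 → HasDerivAt T (T' x) x)
    (hT_expanding : ∀ x ∈ Icc (1/2:ℝ) 1, 1 < |T' x|)
    (a b : ℝ) (ha : a ∈ Ioc (1/2:ℝ) 1) (hb : b ∈ Ioc (1/2:ℝ) 1) :
    |a - b| ≤ |T a - T b| := by
  wlog h : a < b generalizing a b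
  · rcases eq_or_lt_of_le (not_lt.mp h) with h' | h'
    · simp [h']
    · rw [abs_sub_comm a, abs_sub_comm (T a)]
      exact this b a hb ha h'
  have hd : ∀ x ∈ Icc a b, HasDerivAt T (T' x) x := fun x hx =>
    hT_deriv x ⟨by linarith [hx.1, ha.1], by linarith [hx.2, hb.2]⟩
      (by have := hx.1; have := ha.1; intro h; linarith)
  obtain ⟨c, hc, hce⟩ := exists_hasDerivAt_eq_slope T T' h
    (fun x hx => (hd x hx).continuousAt.continuousWithinAt) (fun x hx => hd x (Ioo_subset_Icc_self hx))
  have h1 := hT_expanding c ⟨by linarith [hc.1, ha.1], by linarith [hc.2, hb.2]⟩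
  rw [hce, abs_div, lt_div_iff₀ (abs_pos.mpr (by linarith))] at h1
  rw [abs_sub_comm a, abs_sub_comm (T a)]
  linarith

/-- two-step expansion on the right branch -/
lemma right_expand_two (T T' : ℝ → ℝ)
    (hT_deriv : ∀ x ∈ Icc (0:ℝ) 1, x ≠ 1/2 → HasDerivAt T (T' x) x)
    (hT_C2 : ContDiffOn ℝ 2 T (Icc (1/2:ℝ) 1))
    (hT_bij : BijOn T (Icc (1/2:ℝ) 1) (Icc (0:ℝ) 1))
    (hT_expanding : ∀ x ∈ Icc (1/2:ℝ) 1, 1 < |T' x|) :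
    (T (1/2) = 0 ∨ T (1/2) = 1) ∧
    ∃ r > (1:ℝ), ∀ a ∈ Ioc (1/2:ℝ) 1, ∀ b ∈ Ioc (1/2:ℝ) 1, T a ∈ Ioc (1/2:ℝ) 1 →
      T b ∈ Ioc (1/2:ℝ) 1 → r * |a - b| ≤ |T (T a) - T (T b)| := by
  have hcont : ContinuousOn T (Icc (1/2:ℝ) 1) := hT_C2.continuousOn
  have hmono := hcont.strictMonoOn_of_injOn_Icc' (by norm_num) hT_bij.injOn
  have hhalf : (1/2:ℝ) ∈ Icc (1/2:ℝ) 1 := by norm_num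
  have hTh := hT_bij.mapsTo hhalf
  have hends : T (1/2) = 0 ∨ T (1/2) = 1 := by
    rcases hmono with hm | hm
    · left
      obtain ⟨c, hc, hce⟩ := hT_bij.surjOn (show (0:ℝ) ∈ Icc (0:ℝ) 1 by norm_num)
      have := hm.monotoneOn hhalf hc hc.1
      linarith [hTh.1]
    · right
      obtain ⟨c, hc, hce⟩ := hT_bij.surjOn (show (1:ℝ) ∈ Icc (0:ℝ) 1 by norm_num)
      have := hm.antitoneOn hhalf hc hc.1
      linarith [hTh.2]
  refine ⟨hends, ?_⟩
  have hU : UniqueDiffOn ℝ (Icc (1/2:ℝ) 1) := uniqueDiffOn_Icc (by norm_num)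
  set g := derivWithin T (Icc (1/2:ℝ) 1) with hg
  have hgc : ContinuousOn g (Icc (1/2:ℝ) 1) :=
    hT_C2.continuousOn_derivWithin hU (by norm_num)
  have hgT : ∀ x ∈ Ioc (1/2:ℝ) 1, g x = T' x := fun x hx =>
    (hT_deriv x ⟨by linarith [hx.1], hx.2⟩ hx.1.ne').hasDerivWithinAt.derivWithin
      (hU x ⟨hx.1.le, hx.2⟩)
  have hg1 : ∀ x ∈ Ioc (1/2:ℝ) 1, 1 < |g x| := fun x hx => by
    rw [hgT x hx]; exact hT_expanding x ⟨hx.1.le, hx.2⟩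
  have hgh : 1 ≤ |g (1/2)| := by
    have hcl : (1/2:ℝ) ∈ closure (Ioc (1/2:ℝ) 1) := by
      rw [closure_Ioc (by norm_num)]; exact hhalf
    have hcw : ContinuousWithinAt (fun x => |g x|) (Ioc (1/2:ℝ) 1) (1/2) :=
      ((hgc (1/2) hhalf).mono Ioc_subset_Icc_self).abs
    have := hcw.mem_closure hcl (t := Ici 1) (fun x hx => (hg1 x hx).le)
    simpa using this
  have hgge : ∀ x ∈ Icc (1/2:ℝ) 1, 1 ≤ |g x| := fun x hx => by
    rcases eq_or_lt_of_le hx.1 with h | h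
    · rw [← h]; exact hgh
    · exact (hg1 x ⟨h, hx.2⟩).le
  let K := Icc (1/2:ℝ) 1 ∩ T ⁻¹' Icc (1/2:ℝ) 1
  have hK : IsCompact K := by
    refine isCompact_Icc.of_isClosed_subset ?_ inter_subset_left
    exact hcont.preimage_isClosed_of_isClosed isClosed_Icc isClosed_Icc
  have hcomp : ContinuousOn (fun y => |g (T y) * g y|) K :=
    ((hgc.comp (hcont.mono inter_subset_left) (fun y hy => hy.2)).mul
      (hgc.mono inter_subset_left)).abs
  have hK1 : ∀ y ∈ K, 1 < |g (T y) * g y| := by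
    intro y hy
    rw [abs_mul]
    have h1 := hgge y hy.1
    have h2 := hgge _ hy.2
    rcases eq_or_lt_of_le hy.1.1 with h | h
    · have : T y = 1 := by
        rcases hends with h0 | h0
        · have := hy.2.1
          rw [← h, h0] at this
          norm_num at this
        · rw [← h, h0]
      have h3 := hg1 1 (by norm_num)
      rw [this] at h2 ⊢
      nlinarith
    · have h3 := hg1 y ⟨h, hy.1.2⟩
      nlinarith
  obtain ⟨r, hr1, hr⟩ : ∃ r > (1:ℝ), ∀ y ∈ K, r ≤ |g (T y) * g y| := by
    rcases K.eq_empty_or_nonempty with h | h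
    · exact ⟨2, by norm_num, fun y hy => by rw [h] at hy; exact hy.elim⟩
    · obtain ⟨y, hy, hmin⟩ := hK.exists_isMinOn h hcomp
      exact ⟨_, hK1 y hy, fun x hx => hmin hx⟩
  refine ⟨r, hr1, ?_⟩
  intro a ha b hb hTa hTb
  wlog h : a < b generalizing a b
  · rcases eq_or_lt_of_le (not_lt.mp h) with h' | h'
    · simp [h']
    · rw [abs_sub_comm a, abs_sub_comm (T (T a))]
      exact this b hb a ha hTb hTa h'
  have hI : ∀ x ∈ Icc a b, x ∈ Ioc (1/2:ℝ) 1 := fun x hx =>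
    ⟨lt_of_lt_of_le ha.1 hx.1, hx.2.trans hb.2⟩
  have hTI : ∀ x ∈ Icc a b, T x ∈ Ioc (1/2:ℝ) 1 := by
    intro x hx
    have hx' := Ioc_subset_Icc_self (hI x hx)
    have ha' := Ioc_subset_Icc_self ha
    have hb' := Ioc_subset_Icc_self hb
    rcases hmono with hm | hm
    · exact ⟨lt_of_lt_of_le hTa.1 (hm.monotoneOn ha' hx' hx.1),
        (hm.monotoneOn hx' hb' hx.2).trans hTb.2⟩
    · exact ⟨lt_of_lt_of_le hTb.1 (hm.antitoneOn hx' hb' hx.2),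
        (hm.antitoneOn ha' hx' hx.1).trans hTa.2⟩
  have hD : ∀ x ∈ Ioc (1/2:ℝ) 1, HasDerivAt T (g x) x := fun x hx => by
    rw [hgT x hx]; exact hT_deriv x ⟨by linarith [hx.1], hx.2⟩ hx.1.ne'
  have hd : ∀ x ∈ Icc a b, HasDerivAt (fun y => T (T y)) (g (T x) * g x) x := fun x hx =>
    (hD _ (hTI x hx)).comp x (hD x (hI x hx))
  obtain ⟨c, hc, hce⟩ := exists_hasDerivAt_eq_slope (fun y => T (T y)) (fun x => g (T x) * g x) h
    (fun x hx => (hd x hx).continuousAt.continuousWithinAt) (fun x hx => hd x (Ioo_subset_Icc_self hx))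
  have hc' := Ioo_subset_Icc_self hc
  have h1 := hr c ⟨Ioc_subset_Icc_self (hI c hc'), Ioc_subset_Icc_self (hTI c hc')⟩
  rw [hce, abs_div, le_div_iff₀ (abs_pos.mpr (by linarith))] at h1
  rw [abs_sub_comm a, abs_sub_comm (T (T a))]
  exact h1

/-- Abstract counting argument. -/
lemma abstract_bound (α r : ℝ) (hα0 : 0 < α) (hα1 : α < 1) (hr : 1 < r) (m : ℕ)
    (p d : ℕ → ℝ) (hp0 : ∀ j ≤ m, 0 < p j) (hp1 : ∀ j ≤ m, p j ≤ 1) (hd : ∀ j ≤ m, 0 < d j)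
    (hmono : ∀ j < m, d j ≤ d (j+1))
    (hleft : ∀ j < m, p j ≤ 1/2 → d j / p j ≤ d (j+1) / p (j+1) ∧
      (p (j+1)) ^ (-α) + α / 4 ≤ (p j) ^ (-α))
    (hright : ∀ j, j + 2 ≤ m → 1/2 < p j → 1/2 < p (j+1) → r * d j ≤ d (j+2)) :
    min 1 (min (α/8) (r^α - 1)) / 2 * ((m:ℝ) + 1) ≤ ((d m / p m) / d 0) ^ α := by
  set D := d m / p m with hD
  have hDpos : 0 < D := div_pos (hd m le_rfl) (hp0 m le_rfl)
  have hdD : d m ≤ D := by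
    rw [hD, le_div_iff₀ (hp0 m le_rfl)]
    nlinarith [hp1 m le_rfl, hd m le_rfl]
  have hdm : ∀ k j, j + k = m → d j ≤ d m := by
    intro k
    induction k with
    | zero => intro j hj; simp at hj; rw [hj]
    | succ k ih => intro j hj; exact (hmono j (by omega)).trans (ih (j+1) (by omega))
  have hdm' : ∀ j ≤ m, d j ≤ d m := fun j hj => hdm (m - j) j (by omega)
  have hratio : ∀ k j, j + k = m → d j / p j ≤ 2 * D := by
    intro k
    induction k with
    | zero => intro j hj; simp at hj; rw [hj]; linarith
    | succ k ih =>
      intro j hj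
      by_cases h : p j ≤ 1/2
      · exact (hleft j (by omega) h).1.trans (ih (j+1) (by omega))
      · push Not at h
        rw [div_le_iff₀ (hp0 j (by omega))]
        nlinarith [hdm' j (by omega)]
  have hratio' : ∀ j ≤ m, d j / p j ≤ 2 * D := fun j hj => hratio (m - j) j (by omega)
  set c := min 1 (min (α/8) (r^α - 1)) with hc
  have hra : 1 < r^α := Real.one_lt_rpow hr hα0
  have hc0 : 0 < c := by
    rw [hc]; refine lt_min one_pos (lt_min (by positivity) (by linarith))
  have hc1 : c ≤ 1 := min_le_left _ _
  have hc2 : c ≤ α/8 := (min_le_right _ _).trans (min_le_left _ _)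
  have hc3 : c ≤ r^α - 1 := (min_le_right _ _).trans (min_le_right _ _)
  have hH1 : ∀ j ≤ m, 1 ≤ (D / d j)^α := fun j hj =>
    Real.one_le_rpow ((one_le_div (hd j hj)).mpr ((hdm' j hj).trans hdD)) hα0.le
  have hHmono : ∀ j < m, (D / d (j+1))^α ≤ (D / d j)^α := fun j hj => by
    have h1 := hd (j+1) (by omega)
    have h2 := hd j (by omega)
    exact Real.rpow_le_rpow (by positivity)
      (div_le_div_of_nonneg_left hDpos.le h2 (hmono j hj)) hα0.le
  have hfac : ∀ j ≤ m, (D / d j)^α = (D / (d j / p j))^α * (p j)^(-α) := by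
    intro j hj
    have h1 := hp0 j hj
    have h2 := hd j hj
    rw [Real.rpow_neg h1.le, ← Real.inv_rpow h1.le, ← Real.mul_rpow (by positivity) (by positivity)]
    congr 1
    field_simp
  have hHleft : ∀ j < m, p j ≤ 1/2 → (D / d (j+1))^α + c ≤ (D / d j)^α := by
    intro j hj hpj
    obtain ⟨hl1, hl2⟩ := hleft j hj hpj
    have h1 := hp0 j hj.le
    have h2 := hd j hj.le
    have h3 := hp0 (j+1) hj
    have h4 := hd (j+1) hj
    rw [hfac j hj.le, hfac (j+1) hj]
    have hG : (D / (d (j+1) / p (j+1)))^α ≤ (D / (d j / p j))^α :=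
      Real.rpow_le_rpow (by positivity)
        (div_le_div_of_nonneg_left hDpos.le (by positivity) hl1) hα0.le
    have hG2 : 1/2 ≤ (D / (d j / p j))^α := by
      have h5 : 1/2 ≤ D / (d j / p j) := by
        rw [le_div_iff₀ (by positivity)]
        linarith [hratio' j hj.le]
      have h6 : (1/2:ℝ) ≤ (1/2:ℝ)^α := by
        have := Real.rpow_le_rpow_of_exponent_ge (show (0:ℝ) < 1/2 by norm_num) (by norm_num) hα1.le
        simpa using this
      exact h6.trans (Real.rpow_le_rpow (by norm_num) h5 hα0.le)
    have h7 : 0 < (p (j+1))^(-α) := by positivity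
    have h8 := mul_le_mul_of_nonneg_right hG h7.le
    have h9 := mul_le_mul_of_nonneg_left hl2 (show 0 ≤ (D / (d j / p j))^α by positivity)
    nlinarith
  have htwo : ∀ j, j + 2 ≤ m → (D / d (j+2))^α + c ≤ (D / d j)^α := by
    intro j hj
    by_cases ha : p j ≤ 1/2
    · have := hHleft j (by omega) ha
      have := hHmono (j+1) (by omega)
      linarith
    by_cases hb : p (j+1) ≤ 1/2
    · have := hHleft (j+1) (by omega) hb
      have := hHmono j (by omega)
      linarith
    push Not at ha hb
    have h1 := hright j hj ha hb
    have h2 := hd j (by omega)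
    have h3 := hd (j+2) hj
    have h4 : r^α * (D / d (j+2))^α ≤ (D / d j)^α := by
      rw [← Real.mul_rpow (by linarith) (by positivity)]
      refine Real.rpow_le_rpow (by positivity) ?_ hα0.le
      rw [← mul_div_assoc, div_le_div_iff₀ h3 h2]
      nlinarith
    have h5 := hH1 (j+2) hj
    nlinarith
  have hmain : ∀ k, 2 * k ≤ m → (D / d (2*k))^α + c * k ≤ (D / d 0)^α := by
    intro k
    induction k with
    | zero => intro _; simp
    | succ k ih =>
      intro hk
      have h1 := ih (by omega)
      have h2 := htwo (2*k) (by omega)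
      rw [show 2 * (k+1) = 2 * k + 2 by ring]
      push_cast
      linarith
  have h1 := hmain (m/2) (by omega)
  have h2 := hH1 (2*(m/2)) (by omega)
  have h3 : (m:ℝ) + 1 ≤ 2 * ((m/2 : ℕ):ℝ) + 2 := by
    have : m + 1 ≤ 2 * (m/2) + 2 := by omega
    exact_mod_cast this
  nlinarith

/-- **Polynomial backward contraction** (Lemma `ineq2`): there is `C > 0`
such that for every `m ≥ 1` and all `z, z̃ ∈ (0,1]` whose iterates
`T^j z, T^j z̃` lie in the same atom of the Markov partition for `0 ≤ j ≤ m`,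
`|z - z̃| ≤ (C/(m+1)^{1/α}) |T^m z - T^m z̃| / T^m z`. -/
theorem polynomial_backward_contraction_intermittent_map
    (α : ℝ) (hα0 : 0 < α) (hα1 : α < 1)
    (T : ℝ → ℝ) (hT_maps : MapsTo T (Icc (0:ℝ) 1) (Icc (0:ℝ) 1))
    (hT_formula : ∀ x ∈ Ico (0:ℝ) (1/2), T x = x + (2:ℝ) ^ α * x ^ (1 + α))
    (T' : ℝ → ℝ)
    (hT_deriv : ∀ x ∈ Icc (0:ℝ) 1, x ≠ 1/2 → HasDerivAt T (T' x) x)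
    (hT_C2 : ContDiffOn ℝ 2 T (Icc (1/2:ℝ) 1))
    (hT_bij : BijOn T (Icc (1/2:ℝ) 1) (Icc (0:ℝ) 1))
    (hT_expanding : ∀ x ∈ Icc (1/2:ℝ) 1, 1 < |T' x|)
    -- Markov partition points x_ℓ and atoms I_ℓ = (x_{ℓ+1}, x_ℓ]
    (xpt : ℕ → ℝ) (hx0 : xpt 0 = 1) (hx1 : xpt 1 = 1/2)
    (hxpos : ∀ ℓ, 0 < xpt ℓ) (hxdec : ∀ ℓ, xpt (ℓ + 1) < xpt ℓ)
    (hxpre : ∀ ℓ, 2 ≤ ℓ → xpt ℓ ∈ Ioo (0:ℝ) (1/2) ∧ T (xpt ℓ) = xpt (ℓ - 1)) :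
    ∃ C > (0:ℝ), ∀ m : ℕ, 1 ≤ m → ∀ z ∈ Ioc (0:ℝ) 1, ∀ zt ∈ Ioc (0:ℝ) 1,
      (∀ j ≤ m, ∃ ℓ : ℕ, T^[j] z ∈ Ioc (xpt (ℓ + 1)) (xpt ℓ) ∧
        T^[j] zt ∈ Ioc (xpt (ℓ + 1)) (xpt ℓ)) →
      |z - zt| ≤ (C / ((m : ℝ) + 1) ^ (1/α)) * (|T^[m] z - T^[m] zt| / T^[m] z) := by

  obtain ⟨hends, r, hr1, hr⟩ := right_expand_two T T' hT_deriv hT_C2 hT_bij hT_expanding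
  set c := min 1 (min (α/8) (r^α - 1)) / 2 with hc
  have hra : 1 < r^α := Real.one_lt_rpow hr1 hα0
  have hc0 : 0 < c := by
    rw [hc]; exact half_pos (lt_min one_pos (lt_min (by positivity) (by linarith)))
  refine ⟨(c^(1/α))⁻¹, by positivity, ?_⟩
  intro m _ z hz zt hzt hat
  have hanti : Antitone xpt := antitone_nat_of_succ_le (fun l => (hxdec l).le)
  have hx01 : ∀ l, xpt l ≤ 1 := fun l => hx0 ▸ hanti (Nat.zero_le l)
  have hpos : ∀ l y, y ∈ Ioc (xpt (l+1)) (xpt l) → 0 < y ∧ y ≤ 1 := fun l y hy =>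
    ⟨(hxpos _).trans hy.1, hy.2.trans (hx01 l)⟩
  -- formula on the left
  have hform : ∀ y, 0 < y → y ≤ 1/2 → 0 < T y → T y = y * (1 + (2:ℝ)^α * y^α) := by
    intro y hy hy2 hTy
    rcases eq_or_lt_of_le hy2 with h | h
    · rw [h] at hTy ⊢
      have : T (1/2) = 1 := by
        rcases hends with h0 | h0
        · rw [h0] at hTy; exact absurd hTy (lt_irrefl _)
        · exact h0
      rw [this, ← Real.mul_rpow (by norm_num) (by norm_num)]
      norm_num
    · rw [hT_formula y ⟨hy.le, h⟩, Real.rpow_add hy, Real.rpow_one]; ring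
  have hside : ∀ j ≤ m, (T^[j] z ≤ 1/2 ∧ T^[j] zt ≤ 1/2) ∨
      (T^[j] z ∈ Ioc (1/2:ℝ) 1 ∧ T^[j] zt ∈ Ioc (1/2:ℝ) 1) := by
    intro j hj
    obtain ⟨l, h1, h2⟩ := hat j hj
    rcases Nat.eq_zero_or_pos l with h | h
    · right
      subst h
      simp only [zero_add, hx0, hx1] at h1 h2
      exact ⟨h1, h2⟩
    · left
      have : xpt l ≤ 1/2 := hx1 ▸ hanti h
      exact ⟨h1.2.trans this, h2.2.trans this⟩
  have hpp : ∀ j ≤ m, 0 < T^[j] z ∧ T^[j] z ≤ 1 := fun j hj => by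
    obtain ⟨l, h1, h2⟩ := hat j hj; exact hpos l _ h1
  have hqq : ∀ j ≤ m, 0 < T^[j] zt ∧ T^[j] zt ≤ 1 := fun j hj => by
    obtain ⟨l, h1, h2⟩ := hat j hj; exact hpos l _ h2
  by_cases hne : z = zt
  · subst hne; simp
  have hslope : ∀ j < m, T^[j] z ≤ 1/2 → T^[j+1] z = T^[j] z * (1 + (2:ℝ)^α * (T^[j] z)^α) ∧
      |T^[j] z - T^[j] zt| * (1 + (2:ℝ)^α * (T^[j] z)^α) ≤ |T^[j+1] z - T^[j+1] zt| := by
    intro j hj h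
    have h1 := hpp j hj.le
    have h2 := hqq j hj.le
    have h3 := (hpp (j+1) hj).1
    have h4 := (hqq (j+1) hj).1
    have h5 : T^[j] zt ≤ 1/2 := by
      rcases hside j hj.le with h' | h'
      · exact h'.2
      · exact absurd h'.1.1 (not_lt.mpr h)
    rw [Function.iterate_succ_apply'] at h3 h4 ⊢
    rw [Function.iterate_succ_apply']
    have e1 := hform _ h1.1 h h3
    have e2 := hform _ h2.1 h5 h4
    refine ⟨e1, ?_⟩
    rw [e1, e2]
    exact left_slope α hα0 _ _ _ h1.1 h2.1 (by positivity)
  have hmono : ∀ j < m, |T^[j] z - T^[j] zt| ≤ |T^[j+1] z - T^[j+1] zt| := by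
    intro j hj
    rcases hside j hj.le with h | h
    · have := (hslope j hj h.1).2
      have h1 := (hpp j hj.le).1
      have h2 : 0 ≤ (2:ℝ)^α * (T^[j] z)^α := by positivity
      nlinarith [abs_nonneg (T^[j] z - T^[j] zt)]
    · rw [Function.iterate_succ_apply', Function.iterate_succ_apply']
      exact right_expand_s16 T T' hT_deriv hT_expanding _ _ h.1 h.2
  have hdpos : ∀ j ≤ m, 0 < |T^[j] z - T^[j] zt| := by
    intro j
    induction j with
    | zero => intro _; simpa [sub_eq_zero] using hne
    | succ j ih => intro hj; exact (ih (by omega)).trans_le (hmono j (by omega))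
  have key := abstract_bound α r hα0 hα1 hr1 m (fun j => T^[j] z) (fun j => |T^[j] z - T^[j] zt|)
    (fun j hj => (hpp j hj).1) (fun j hj => (hpp j hj).2) hdpos hmono
    (by
      intro j hj h
      obtain ⟨e, s⟩ := hslope j hj h
      have h1 := (hpp j hj.le).1
      have h2 := (hpp (j+1) hj).1
      refine ⟨?_, ?_⟩
      · rw [div_le_div_iff₀ h1 h2, e]
        rw [e] at s
        nlinarith [mul_le_mul_of_nonneg_right s h1.le]
      · rw [e]
        exact left_gain α hα0 hα1 _ h1 h)
    (by
      intro j hj h h'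
      have s1 : T^[j] z ∈ Ioc (1/2:ℝ) 1 ∧ T^[j] zt ∈ Ioc (1/2:ℝ) 1 :=
        (hside j (by omega)).resolve_left (fun hh => absurd hh.1 (not_le.mpr h))
      have s2 : T^[j+1] z ∈ Ioc (1/2:ℝ) 1 ∧ T^[j+1] zt ∈ Ioc (1/2:ℝ) 1 :=
        (hside (j+1) (by omega)).resolve_left (fun hh => absurd hh.1 (not_le.mpr h'))
      rw [Function.iterate_succ_apply', Function.iterate_succ_apply'] at s2
      have := hr _ s1.1 _ s1.2 s2.1 s2.2
      simp only [Function.iterate_succ_apply']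
      exact this)
  simp only [Function.iterate_zero, id] at key
  rw [← hc] at key
  have hd0 : 0 < |z - zt| := by simpa using hdpos 0 (Nat.zero_le m)
  have hDm : 0 < |T^[m] z - T^[m] zt| / T^[m] z := div_pos (hdpos m le_rfl) (hpp m le_rfl).1
  set D := |T^[m] z - T^[m] zt| / T^[m] z with hD
  have hm1 : (0:ℝ) < (m:ℝ) + 1 := by positivity
  have k2 := Real.rpow_le_rpow (by positivity) key (show 0 ≤ 1/α by positivity)
  rw [← Real.rpow_mul (by positivity), mul_one_div_cancel hα0.ne', Real.rpow_one,
    Real.mul_rpow hc0.le hm1.le, le_div_iff₀ hd0] at k2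
  have hA : 0 < c^(1/α) := by positivity
  have hB : 0 < ((m:ℝ)+1)^(1/α) := by positivity
  have : (c^(1/α))⁻¹ / ((m:ℝ)+1)^(1/α) * D = D / (c^(1/α) * ((m:ℝ)+1)^(1/α)) := by
    field_simp
  rw [this, le_div_iff₀ (by positivity)]
  linarith
end
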